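/- arXiv:2505.00262 — 4 statements merged into one kernel-verified Lean document; each statement's English description precedes it below -/
import Mathlib

section
/- Suppose the HNN-extension 𝔼 = ⟨B, t; t⁻¹Ht = K, φ⟩ satisfies condition (*) and 𝒞 is a root class of groups consisting only of periodic groups and closed under taking quotient groups. If H and K are locally cyclic groups, then: (1) if B/H and B/K are residually 𝒞-groups, then the group H/L is finite if and only if H/L ∈ 𝒞; (2) if B is residually a 𝒞-group, then L is finite if and only if there exists a homomorphism of B onto a group from 𝒞 acting injectively on L; (3) if H/L is finite, 𝔉 ∈ 𝒞, and B is 𝒞-quasi-regular with respect to L, then 𝔼 is residually a 𝒞-group if and only if B, B/H, and B/K are residually 𝒞-groups; (4) if L is finite and B is 𝒞-quasi-regular with respect to HK, then 𝔼 is residually a 𝒞-group if and only if B, B/H, and B/K are residually 𝒞-groups and 𝔉 ∈ 𝒞. -/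
universe u

open Subgroup

/-- A class of groups in universe `u`: a property of groups. -/
abbrev GroupClass : Type (u + 1) := (G : Type u) → [inst : Group G] → Prop

/-- The class is closed under isomorphism. -/
def IsoClosed (C : GroupClass.{u}) : Prop :=
  ∀ (G₁ G₂ : Type u) [Group G₁] [Group G₂], (G₁ ≃* G₂) → C G₁ → C G₂

/-- The class is closed under taking subgroups. -/
def SubgroupClosed (C : GroupClass.{u}) : Prop :=
  ∀ (G : Type u) [Group G] (H : Subgroup G), C G → C H

/-- The class is closed under taking quotient groups. -/
def QuotClosed (C : GroupClass.{u}) : Prop :=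
  ∀ (G : Type u) [Group G] (N : Subgroup G) [N.Normal], C G → C (G ⧸ N)

/-- The class is closed under direct products of a finite number of factors. -/
def FinProdClosed (C : GroupClass.{u}) : Prop :=
  ∀ (ι : Type u) [Finite ι] (G : ι → Type u) [∀ i, Group (G i)],
    (∀ i, C (G i)) → C (∀ i, G i)

/-- Gruenberg's condition. -/
def Gruenberg (C : GroupClass.{u}) : Prop :=
  ∀ (X : Type u) [Group X] (Y Z : Subgroup X) (_ : Z ≤ Y) (hY : Y.Normal)
    (hZY : (Z.subgroupOf Y).Normal), C (X ⧸ Y) → C (↥Y ⧸ Z.subgroupOf Y) →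
    ∃ T : Subgroup X, ∃ _ : T.Normal, T ≤ Z ∧ C (X ⧸ T)

/-- A root class of groups. -/
def IsRootClass (C : GroupClass.{u}) : Prop :=
  IsoClosed C ∧ (∃ (G : Type u) (_ : Group G), C G ∧ Nontrivial G) ∧
    SubgroupClosed C ∧ Gruenberg C

/-- `X` is residually a `C`-group. -/
def Residually (C : GroupClass.{u}) (X : Type u) [Group X] : Prop :=
  ∀ x : X, x ≠ 1 → ∃ (G : Type u) (_ : Group G) (f : X →* G),
    Function.Surjective f ∧ C G ∧ f x ≠ 1

/-- Every element has finite order. -/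
def Periodic (G : Type u) [Group G] : Prop := ∀ g : G, IsOfFinOrder g

/-- The class consists only of periodic groups. -/
def PeriodicClass (C : GroupClass.{u}) : Prop := ∀ (G : Type u) [Group G], C G → Periodic G

/-- `Aut_X(Y)`: the subgroup of `Aut(Y)` consisting of the restrictions to `Y`
of the inner automorphisms of `X` (that leave `Y` invariant; when `Y` is normal
in `X` these are the restrictions of all inner automorphisms of `X`). -/
def autOf (X : Type u) [Group X] (Y : Subgroup X) : Subgroup (MulAut Y) where
  carrier := { α | ∃ x : X, ∀ y : Y, ((α y : Y) : X) = x * y * x⁻¹ }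
  one_mem' := ⟨1, fun y => by simp⟩
  mul_mem' := by
    rintro α β ⟨a, ha⟩ ⟨b, hb⟩
    refine ⟨a * b, fun y => ?_⟩
    have h1 : ((α (β y) : Y) : X) = a * (β y) * a⁻¹ := ha (β y)
    have h2 : ((β y : Y) : X) = b * y * b⁻¹ := hb y
    show ((α (β y) : Y) : X) = _
    rw [h1, h2]; group
  inv_mem' := by
    rintro α ⟨a, ha⟩
    refine ⟨a⁻¹, fun y => ?_⟩
    have h : ((α (α⁻¹ y) : Y) : X) = a * (α⁻¹ y) * a⁻¹ := ha (α⁻¹ y)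
    rw [MulAut.apply_inv_self] at h
    rw [h]; group

/-- Conjugation of automorphism groups along an isomorphism `φ : H ≃* K`,
giving `φ ∘ α ∘ φ⁻¹ : Aut K →* Aut H`. -/
def autConjHom {H K : Type u} [Group H] [Group K] (φ : H ≃* K) : MulAut K →* MulAut H where
  toFun α := (φ.trans α).trans φ.symm
  map_one' := by ext x; simp
  map_mul' := fun α β => by
    ext x
    simp [MulAut.mul_apply, MulEquiv.trans_apply, MulEquiv.apply_symm_apply]

/-- `N ∈ 𝒞*(X)`: `N` is normal in `X` and `X/N ∈ 𝒞`. -/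
def inCStar (C : GroupClass.{u}) (X : Type u) [Group X] (N : Subgroup X) : Prop :=
  ∃ _ : N.Normal, C (X ⧸ N)

/-- `X` is `𝒞`-quasi-regular with respect to its subgroup `Y`. -/
def QuasiRegular (C : GroupClass.{u}) (X : Type u) [Group X] (Y : Subgroup X) : Prop :=
  ∀ M : Subgroup Y, inCStar C Y M → ∃ N : Subgroup X, inCStar C X N ∧ N.subgroupOf Y ≤ M

/-- `𝔓(𝒞)`: the set of primes dividing the order of some element of some `𝒞`-group. -/
def primesOf (C : GroupClass.{u}) : Set ℕ :=
  { p | p.Prime ∧ ∃ (Z : Type u) (_ : Group Z), C Z ∧ ∃ z : Z, p ∣ orderOf z }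

/-- `Y` is `𝔓(𝒞)′`-isolated in `X`. -/
def PIsolated (C : GroupClass.{u}) {X : Type u} [Group X] (Y : Subgroup X) : Prop :=
  ∀ (x : X) (q : ℕ), q.Prime → q ∉ primesOf C → x ^ q ∈ Y → x ∈ Y

/-- Every finitely generated subgroup is cyclic. -/
def LocallyCyclic (G : Type u) [Group G] : Prop :=
  ∀ S : Subgroup G, S.FG → IsCyclic S

/-- `A` is a `𝒞`-bounded abelian group. -/
def CBoundedAbelian (C : GroupClass.{u}) (A : Type u) [Group A] : Prop :=
  (∀ a b : A, a * b = b * a) ∧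
  ∀ (N : Subgroup A), ∀ _ : N.Normal, ∀ p ∈ primesOf C,
    (∃ m : ℕ, 0 < m ∧ ∀ x : A ⧸ N, (∃ n : ℕ, x ^ p ^ n = 1) → x ^ m = 1) ∧
    (∃ (Z : Type u) (_ : Group Z), C Z ∧
      Cardinal.mk {x : A ⧸ N // ∃ n : ℕ, x ^ p ^ n = 1} ≤ Cardinal.mk Z)

/-- `X` is a `𝒞`-bounded nilpotent group: it has a finite central series with
`𝒞`-bounded abelian factors. -/
def CBoundedNilpotent (C : GroupClass.{u}) (X : Type u) [Group X] : Prop :=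
  ∃ (n : ℕ) (S : ℕ → Subgroup X), S 0 = ⊥ ∧ S n = ⊤ ∧
    (∀ i < n, S i ≤ S (i + 1)) ∧ (∀ i < n, (S i).Normal) ∧
    (∀ i < n, ∀ x ∈ S (i + 1), ∀ g : X, g⁻¹ * x⁻¹ * g * x ∈ S i) ∧
    (∀ i < n, ∀ _ : ((S i).subgroupOf (S (i + 1))).Normal,
      CBoundedAbelian C (↥(S (i + 1)) ⧸ (S i).subgroupOf (S (i + 1))))

/-- `A` is a normal subgroup of `U` (as subgroups of a common group). -/
def NormalIn {G : Type u} [Group G] (A U : Subgroup G) : Prop := (A.subgroupOf U).Normal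

/-- `G` satisfies a non-trivial identity. -/
def SatisfiesNontrivialIdentity (G : Type u) [Group G] : Prop :=
  ∃ w : FreeGroup ℕ, w ≠ 1 ∧ ∀ f : FreeGroup ℕ →* G, f w = 1

section HNN

variable {B : Type u} [Group B] (H K : Subgroup B) (φ : H ≃* K)

/-- `𝔎 = φ ∘ Aut_B(K) ∘ φ⁻¹`, as a subgroup of `Aut(H)`. -/
def frakK : Subgroup (MulAut H) := (autOf B K).map (autConjHom φ)

/-- `𝔘 = ⟨𝔥, 𝔎⟩ ≤ Aut(H)`. -/
def frakU : Subgroup (MulAut H) := autOf B H ⊔ frakK H K φ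

/-- `𝔙 = ⟨𝔏, 𝔉⟩ ≤ Aut(L)`, where `ψ = φ|_L`. -/
def frakV (ψ : MulAut ↥(H ⊓ K)) : Subgroup (MulAut ↥(H ⊓ K)) :=
  autOf B (H ⊓ K) ⊔ Subgroup.zpowers ψ

/-- `ψ` is the restriction of `φ` to `L = H ⊓ K` (this encodes the
`φ`-invariance of `L` from condition (*)). -/
def IsRestrictionToL (ψ : MulAut ↥(H ⊓ K)) : Prop :=
  ∀ x : ↥(H ⊓ K), ((ψ x : ↥(H ⊓ K)) : B) = ((φ ⟨(x : B), x.2.1⟩ : K) : B)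

/-- `(H ⊓ K)φ = H ⊓ K` : the `φ`-invariance of `L` from condition (*). -/
def PhiInvL : Prop :=
  ((H ⊓ K).subgroupOf H).map φ.toMonoidHom = (H ⊓ K).subgroupOf K

end HNN

section HNNExtra

variable (C : GroupClass.{u}) {B : Type u} [Group B] (H K : Subgroup B) (φ : H ≃* K)

/-- Condition (†): at least one of `𝔥` and `𝔎` is normal in `𝔘`, or `𝔘 ∈ 𝒞`. -/
def CondDag : Prop :=
  NormalIn (autOf B H) (frakU H K φ) ∨ NormalIn (frakK H K φ) (frakU H K φ) ∨
    C ↥(frakU H K φ)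

/-- Condition (‡): at least one of `𝔏` and `𝔉` is normal in `𝔙`, or `𝔙 ∈ 𝒞`. -/
def CondDDag (ψ : MulAut ↥(H ⊓ K)) : Prop :=
  NormalIn (autOf B (H ⊓ K)) (frakV H K ψ) ∨
    NormalIn (Subgroup.zpowers ψ) (frakV H K ψ) ∨ C ↥(frakV H K ψ)

/-- `Q` is a pre-`𝒞`-admissible subgroup of `B`: it is normal, `(H,K,φ)`-compatible,
`B/Q ∈ 𝒞`, and `HQ/Q ∩ KQ/Q = LQ/Q`. -/
def PreAdmissible (Q : Subgroup B) : Prop :=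
  ∃ _ : Q.Normal, ((Q ⊓ H).subgroupOf H).map φ.toMonoidHom = (Q ⊓ K).subgroupOf K ∧
    C (B ⧸ Q) ∧
    (H.map (QuotientGroup.mk' Q)) ⊓ (K.map (QuotientGroup.mk' Q)) =
      (H ⊓ K).map (QuotientGroup.mk' Q)

end HNNExtra

section Closure

variable {C : GroupClass.{u}}

theorem IsRootClass.of_injective (hC : IsRootClass C) {X G : Type u} [Group X] [Group G]
    (f : X →* G) (hf : Function.Injective f) (hG : C G) : C X :=
  hC.1 _ _ (MonoidHom.ofInjective hf).symm (hC.2.2.1 _ f.range hG)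

theorem IsRootClass.trivial (hC : IsRootClass C) (X : Type u) [Group X] [Subsingleton X] :
    C X := by
  obtain ⟨G, _, hG, -⟩ := hC.2.1
  exact hC.of_injective (1 : X →* G) (fun _ _ _ => Subsingleton.elim _ _) hG

theorem IsRootClass.ker_mem (hC : IsRootClass C) {X G : Type u} [Group X] [Group G]
    (f : X →* G) (hG : C G) : inCStar C X f.ker :=
  ⟨inferInstance, hC.1 _ _ (QuotientGroup.quotientKerEquivRange f).symm (hC.2.2.1 _ f.range hG)⟩

theorem IsRootClass.of_extension (hC : IsRootClass C) {X G : Type u} [Group X] [Group G]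
    (f : X →* G) (hG : C G) (hker : C f.ker) : C X := by
  obtain ⟨_, hX⟩ := hC.ker_mem f hG
  have h1 : (⊥ : Subgroup X).subgroupOf f.ker = ⊥ := by simp
  obtain ⟨T, hT, hTb, hCT⟩ := hC.2.2.2 X f.ker ⊥ bot_le inferInstance (by rw [h1]; infer_instance)
    hX (hC.1 _ _ ((QuotientGroup.quotientMulEquivOfEq h1).trans
      QuotientGroup.quotientBot).symm hker)
  obtain rfl : T = ⊥ := le_bot_iff.mp hTb
  exact hC.1 _ _ QuotientGroup.quotientBot hCT

theorem IsRootClass.prod (hC : IsRootClass C) {X Y : Type u} [Group X] [Group Y]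
    (hX : C X) (hY : C Y) : C (X × Y) := by
  refine hC.of_extension (MonoidHom.snd X Y) hY
    (hC.of_injective ((MonoidHom.fst X Y).comp (Subgroup.subtype _)) ?_ hX)
  rintro ⟨⟨a, b⟩, hb⟩ ⟨⟨c, d⟩, hd⟩ h
  simp only [MonoidHom.mem_ker, MonoidHom.coe_snd] at hb hd
  subst hb hd
  simpa using h

/-- The action of `R` on functions `R → M` by translation of the argument combined with an
action `θ` on the values. -/
def twistedShift {R M : Type*} [Group R] [Group M] (θ : R →* MulAut M) :
    R →* MulAut (R → M) where
  toFun x :=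
    { toFun := fun F y => θ x (F (x⁻¹ * y))
      invFun := fun F y => (θ x)⁻¹ (F (x * y))
      left_inv := fun F => by ext y; simp
      right_inv := fun F => by ext y; simp
      map_mul' := fun F F' => by ext y; simp }
  map_one' := by ext F y; simp
  map_mul' x x' := by ext F y; simp [mul_assoc]

@[simp]
theorem twistedShift_apply {R M : Type*} [Group R] [Group M] (θ : R →* MulAut M) (x : R)
    (F : R → M) (y : R) : twistedShift θ x F y = θ x (F (x⁻¹ * y)) := rfl

@[simp]
theorem twistedShift_symm_apply {R M : Type*} [Group R] [Group M] (θ : R →* MulAut M) (x : R)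
    (F : R → M) (y : R) : (twistedShift θ x).symm F y = (θ x)⁻¹ (F (x * y)) := rfl

/-- A root class contains the unrestricted direct power of any of its groups, the exponent being
the underlying set of another one. -/
theorem IsRootClass.power (hC : IsRootClass C) {R M : Type u} [Group R] [Group M]
    (hR : C R) (hM : C M) : C (R → M) := by
  let W := (R → M) ⋊[twistedShift (1 : R →* MulAut M)] R
  let Y : Subgroup W := (SemidirectProduct.rightHom : W →* R).ker
  have hY : ∀ w : Y, (w : W).right = 1 := fun w => w.2
  let ev : Y →* M :=
    { toFun := fun w => (w : W).left 1
      map_one' := rfl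
      map_mul' := fun a b => by
        change ((a : W).left * twistedShift 1 (a : W).right (b : W).left) 1 = _
        simp [hY a] }
  let Z : Subgroup W := ev.ker.map Y.subtype
  have hZ : Z.subgroupOf Y = ev.ker := by
    ext w; simp [Z, Subgroup.mem_subgroupOf]
  have hZn : (Z.subgroupOf Y).Normal := by rw [hZ]; infer_instance
  have hZY : Z ≤ Y := by
    rintro _ ⟨w, -, rfl⟩; exact w.2
  obtain ⟨_, h1⟩ := hC.ker_mem (SemidirectProduct.rightHom : W →* R) hR
  obtain ⟨_, h2⟩ := hC.ker_mem ev hM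
  obtain ⟨T, hT, hTZ, hCT⟩ := hC.2.2.2 W Y Z hZY inferInstance hZn h1
    (hC.1 _ _ (QuotientGroup.quotientMulEquivOfEq hZ).symm h2)
  refine hC.of_injective ((QuotientGroup.mk' T).comp SemidirectProduct.inl) ?_ hCT
  rw [injective_iff_map_eq_one]
  intro F hF
  have hF : (SemidirectProduct.inl F : W) ∈ T := by simpa using hF
  ext y
  obtain ⟨w, hw, hw'⟩ := hTZ (hT.conj_mem _ hF (SemidirectProduct.inr y⁻¹))
  have hw1 : (w : W).left 1 = 1 := hw
  have hw2 : (w : W) = SemidirectProduct.inl (twistedShift 1 y⁻¹ F) := by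
    rw [SemidirectProduct.inl_aut, map_inv SemidirectProduct.inr y⁻¹]
    exact hw'
  rw [hw2, SemidirectProduct.left_inl, twistedShift_apply] at hw1
  simpa using hw1

theorem IsRootClass.twisted_wreath (hC : IsRootClass C) {R M : Type u} [Group R] [Group M]
    (hR : C R) (hM : C M) (θ : R →* MulAut M) : C ((R → M) ⋊[twistedShift θ] R) := by
  refine hC.of_extension SemidirectProduct.rightHom hR ?_
  rw [← SemidirectProduct.range_inl_eq_ker_rightHom]
  exact hC.1 _ _ (MonoidHom.ofInjective SemidirectProduct.inl_injective) (hC.power hR hM)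

theorem IsRootClass.of_surjective (hC : IsRootClass C) (hquot : QuotClosed C)
    {X G : Type u} [Group X] [Group G] (f : X →* G) (hf : Function.Surjective f) (hX : C X) :
    C G :=
  hC.1 _ _ (QuotientGroup.quotientKerEquivOfSurjective f hf) (hquot X f.ker hX)

/-- The image of `f` is a quotient of the image of `g` as soon as `g` has the smaller kernel. -/
theorem IsRootClass.range_of_ker_le (hC : IsRootClass C) (hquot : QuotClosed C) {S : Type*}
    {G X : Type u} [Group S] [Group G] [Group X] (g : S →* G) (f : S →* X)
    (h : ∀ s, g s = 1 → f s = 1) (hG : C G) : C f.range := by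
  refine hC.of_surjective hquot (X := g.range)
    ((QuotientGroup.lift g.ker f.rangeRestrict fun s hs => ?_).comp
      (QuotientGroup.quotientKerEquivRange g).symm.toMonoidHom) ?_ (hC.2.2.1 _ _ hG)
  · exact Subtype.ext (h s hs)
  · rintro ⟨_, s, rfl⟩
    refine ⟨QuotientGroup.quotientKerEquivRange g (s : S ⧸ g.ker), ?_⟩
    simp
    rfl

theorem IsRootClass.zpowers_of_zpow_eq_one (hC : IsRootClass C) (hquot : QuotClosed C)
    {G X : Type u} [Group G] [Group X] {g : G} {x : X}
    (h : ∀ n : ℤ, g ^ n = 1 → x ^ n = 1) (hG : C (Subgroup.zpowers g)) :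
    C (Subgroup.zpowers x) := by
  have h1 : (zpowersHom X x).range = Subgroup.zpowers x := by
    ext y; simp [Subgroup.mem_zpowers_iff, MonoidHom.mem_range]
  rw [← h1]
  refine hC.range_of_ker_le hquot
    (zpowersHom (Subgroup.zpowers g) ⟨g, Subgroup.mem_zpowers g⟩) _ (fun n hn => ?_) hG
  simp only [zpowersHom_apply] at hn ⊢
  exact h _ (by simpa using congrArg Subtype.val hn)

theorem IsRootClass.of_sup_eq_top (hC : IsRootClass C) (hquot : QuotClosed C)
    {X : Type u} [Group X] {S T : Subgroup X} [S.Normal] (h : S ⊔ T = ⊤) (hS : C S) (hT : C T) :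
    C X := by
  refine hC.of_extension (QuotientGroup.mk' S)
    (hC.of_surjective hquot ((QuotientGroup.mk' S).comp T.subtype) ?_ hT) ?_
  · intro x
    obtain ⟨x, rfl⟩ := QuotientGroup.mk_surjective x
    obtain ⟨s, hs, t, ht, rfl⟩ := Subgroup.mem_sup_of_normal_left.mp (h.ge (Subgroup.mem_top x))
    refine ⟨⟨t, ht⟩, ?_⟩
    simpa [QuotientGroup.eq] using hs
  · rwa [QuotientGroup.ker_mk']

/-- The groups of a root class of periodic groups have finite exponent. -/
theorem IsRootClass.exists_pow_eq_one (hC : IsRootClass C) (hper : PeriodicClass C)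
    {G : Type u} [Group G] (hG : C G) : ∃ n : ℕ, 0 < n ∧ ∀ g : G, g ^ n = 1 := by
  obtain ⟨n, hn, h⟩ := (hper _ (hC.power hG hG) (id : G → G)).exists_pow_eq_one
  exact ⟨n, hn, fun g => congrFun h g⟩

theorem IsRootClass.inf_mem (hC : IsRootClass C) {X : Type u} [Group X] {N N' : Subgroup X}
    (h : inCStar C X N) (h' : inCStar C X N') : inCStar C X (N ⊓ N') := by
  obtain ⟨_, h⟩ := h
  obtain ⟨_, h'⟩ := h'
  have := hC.ker_mem ((QuotientGroup.mk' N).prod (QuotientGroup.mk' N')) (hC.prod h h')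
  rwa [MonoidHom.ker_prod, QuotientGroup.ker_mk', QuotientGroup.ker_mk'] at this

theorem IsRootClass.top_mem (hC : IsRootClass C) (X : Type u) [Group X] : inCStar C X ⊤ :=
  ⟨inferInstance, haveI := QuotientGroup.subsingleton_quotient_top (G := X); hC.trivial _⟩

/-- A finite number of properties inherited by smaller subgroups are realized simultaneously in
`𝒞*(X)` if each of them is realized separately. -/
theorem IsRootClass.exists_mem_forall (hC : IsRootClass C) {X : Type u} [Group X] {ι : Type*}
    {s : Set ι} (hs : s.Finite) (P : ι → Subgroup X → Prop)
    (hP : ∀ i N N', N' ≤ N → P i N → P i N')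
    (h : ∀ i ∈ s, ∃ N, inCStar C X N ∧ P i N) : ∃ N, inCStar C X N ∧ ∀ i ∈ s, P i N := by
  induction s, hs using Set.Finite.induction_on with
  | empty => exact ⟨⊤, hC.top_mem X, by simp⟩
  | @insert a s _ _ ih =>
    obtain ⟨N, hN, hNP⟩ := ih fun i hi => h i (Set.mem_insert_of_mem _ hi)
    obtain ⟨N', hN', hNP'⟩ := h a (Set.mem_insert _ _)
    refine ⟨N ⊓ N', hC.inf_mem hN hN', ?_⟩
    rintro i (rfl | hi)
    · exact hP _ _ _ inf_le_right hNP'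
    · exact hP _ _ _ inf_le_left (hNP i hi)

theorem IsRootClass.residually_iff (hC : IsRootClass C) {X : Type u} [Group X] :
    Residually C X ↔ ∀ x : X, x ≠ 1 → ∃ N, inCStar C X N ∧ x ∉ N := by
  refine forall₂_congr fun x _ => ⟨?_, ?_⟩
  · rintro ⟨G, _, f, -, hG, hx⟩
    exact ⟨f.ker, hC.ker_mem f hG, hx⟩
  · rintro ⟨N, ⟨_, hN⟩, hx⟩
    exact ⟨X ⧸ N, inferInstance, QuotientGroup.mk' N, QuotientGroup.mk'_surjective N, hN,
      by simpa using hx⟩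

theorem IsRootClass.residually_quotient_iff (hC : IsRootClass C) {X : Type u} [Group X]
    (Y : Subgroup X) [Y.Normal] :
    Residually C (X ⧸ Y) ↔ ∀ x ∉ Y, ∃ N, inCStar C X N ∧ Y ≤ N ∧ x ∉ N := by
  rw [hC.residually_iff]
  constructor
  · intro h x hx
    obtain ⟨N, ⟨_, hN⟩, hxN⟩ := h (x : X ⧸ Y) (by simpa using hx)
    have := hC.ker_mem ((QuotientGroup.mk' N).comp (QuotientGroup.mk' Y)) hN
    refine ⟨_, this, fun y hy => ?_, ?_⟩
    · simp [MonoidHom.mem_ker, (QuotientGroup.eq_one_iff y).mpr hy]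
    · simpa [MonoidHom.mem_ker] using hxN
  · intro h x hx
    obtain ⟨x, rfl⟩ := QuotientGroup.mk_surjective x
    obtain ⟨N, ⟨_, hN⟩, hYN, hxN⟩ := h x (by simpa using hx)
    refine ⟨_, hC.ker_mem (QuotientGroup.lift Y (QuotientGroup.mk' N) fun y hy => ?_) hN, ?_⟩
    · simpa using hYN hy
    · simpa [MonoidHom.mem_ker] using hxN

theorem IsRootClass.exists_mem_inf_eq_bot (hC : IsRootClass C) {X : Type u} [Group X]
    (hX : Residually C X) (F : Subgroup X) [Finite F] : ∃ N, inCStar C X N ∧ N ⊓ F = ⊥ := by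
  obtain ⟨N, hN, h⟩ := hC.exists_mem_forall (X := X) (s := {x | x ∈ F ∧ x ≠ 1})
    (Set.Finite.subset (Set.toFinite (F : Set X)) fun x hx => hx.1) (fun x N => x ∉ N)
    (fun i N N' h hi hi' => hi (h hi')) (fun x hx => hC.residually_iff.mp hX x hx.2)
  refine ⟨N, hN, (Subgroup.eq_bot_iff_forall _).mpr fun x hx => ?_⟩
  by_contra h1
  exact h x ⟨hx.2, h1⟩ hx.1

end Closure

section LocallyCyclic

variable {C : GroupClass.{u}}

theorem LocallyCyclic.exists_zpow {X : Type u} [Group X] (hX : LocallyCyclic X) (x y : X) :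
    ∃ (c : X) (i j : ℤ), c ^ i = x ∧ c ^ j = y := by
  have hfg : (Subgroup.closure {x, y}).FG := (Subgroup.fg_iff _).mpr ⟨_, rfl, Set.toFinite _⟩
  obtain ⟨⟨c, hc⟩, h⟩ := hX _ hfg
  obtain ⟨i, hi⟩ := h ⟨x, Subgroup.subset_closure (by simp)⟩
  obtain ⟨j, hj⟩ := h ⟨y, Subgroup.subset_closure (by simp)⟩
  exact ⟨c, i, j, congrArg Subtype.val hi, congrArg Subtype.val hj⟩

protected theorem LocallyCyclic.mul_comm {X : Type u} [Group X] (hX : LocallyCyclic X) (x y : X) :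
    x * y = y * x := by
  obtain ⟨c, i, j, rfl, rfl⟩ := hX.exists_zpow x y
  exact zpow_mul_comm c i j

/-- A homomorphism from a locally cyclic group to a group of finite exponent has a cyclic image
and its kernel is the subgroup of `m`-th powers for some positive `m`. -/
theorem LocallyCyclic.exists_generator {X G : Type u} [Group X] [Group G] (hX : LocallyCyclic X)
    (f : X →* G) {n : ℕ} (hn : 0 < n) (hf : ∀ x, f x ^ n = 1) :
    ∃ (g : X) (m : ℕ), 0 < m ∧ (∀ x, ∃ k : ℤ, f x = f g ^ k) ∧
      ∀ x, f x = 1 ↔ ∃ y, y ^ m = x := by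
  have hbdd : ∀ x, orderOf (f x) ≤ n := fun x => orderOf_le_of_pow_eq_one hn (hf x)
  have hfin : ∀ x, 0 < orderOf (f x) := fun x =>
    (isOfFinOrder_iff_pow_eq_one.mpr ⟨n, hn, hf x⟩).orderOf_pos
  obtain ⟨g, hg⟩ : ∃ g, ∀ x, orderOf (f x) ≤ orderOf (f g) := by
    obtain ⟨m, ⟨g, hg⟩, hm⟩ := (BddAbove.finite (s := Set.range fun x => orderOf (f x))
      ⟨n, by rintro _ ⟨x, rfl⟩; exact hbdd x⟩).exists_maximal ⟨_, 1, rfl⟩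
    refine ⟨g, fun x => ?_⟩
    by_contra! hlt
    have := hm ⟨x, rfl⟩ (by rw [← hg]; exact hlt.le)
    rw [← hg] at this
    exact absurd this (not_le.mpr hlt)
  have key : ∀ (c : X) (i : ℤ), c ^ i = g → orderOf (f c) = orderOf (f g) := by
    rintro c i hc
    refine le_antisymm (hg c) (Nat.le_of_dvd (hfin c) ?_)
    rw [← hc, map_zpow]
    exact orderOf_dvd_of_mem_zpowers ⟨i, rfl⟩
  refine ⟨g, orderOf (f g), hfin g, fun x => ?_, fun x => ⟨fun hx => ?_, ?_⟩⟩
  · obtain ⟨c, i, j, hi, rfl⟩ := hX.exists_zpow g x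
    have hle : Subgroup.zpowers (f g) ≤ Subgroup.zpowers (f c) := by
      rw [Subgroup.zpowers_le, ← hi, map_zpow]
      exact ⟨i, rfl⟩
    have hfc : Finite (Subgroup.zpowers (f c)) :=
      (isOfFinOrder_iff_pow_eq_one.mpr ⟨n, hn, hf c⟩).finite_zpowers
    have heq := Subgroup.eq_of_le_of_card_ge hle
      (by rw [Nat.card_zpowers, Nat.card_zpowers, key c i hi])
    have : f (c ^ j) ∈ Subgroup.zpowers (f g) := by
      rw [heq, map_zpow]; exact ⟨j, rfl⟩
    obtain ⟨k, hk⟩ := this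
    exact ⟨k, hk.symm⟩
  · obtain ⟨c, i, j, hi, rfl⟩ := hX.exists_zpow g x
    rw [map_zpow, ← orderOf_dvd_iff_zpow_eq_one, key c i hi] at hx
    obtain ⟨l, rfl⟩ := hx
    exact ⟨c ^ l, by rw [← zpow_natCast, ← zpow_mul, mul_comm]⟩
  · rintro ⟨y, rfl⟩
    rw [map_pow, ← orderOf_dvd_iff_pow_eq_one]
    obtain ⟨c, i, j, hi, rfl⟩ := hX.exists_zpow g y
    rw [map_zpow, ← key c i hi]
    exact orderOf_dvd_of_mem_zpowers ⟨j, rfl⟩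

theorem LocallyCyclic.map_mulAut_eq_one_iff {X G : Type u} [Group X] [Group G]
    (hX : LocallyCyclic X) (f : X →* G) {n : ℕ} (hn : 0 < n) (hf : ∀ x, f x ^ n = 1)
    (θ : MulAut X) (x : X) : f (θ x) = 1 ↔ f x = 1 := by
  obtain ⟨-, m, -, -, h⟩ := hX.exists_generator f hn hf
  rw [h, h]
  constructor
  · rintro ⟨y, hy⟩
    exact ⟨θ.symm y, by rw [← map_pow, hy]; exact θ.symm_apply_apply x⟩
  · rintro ⟨y, rfl⟩
    exact ⟨θ y, (map_pow θ y m).symm⟩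

theorem LocallyCyclic.finite_range {X G : Type u} [Group X] [Group G] (hX : LocallyCyclic X)
    (f : X →* G) {n : ℕ} (hn : 0 < n) (hf : ∀ x, f x ^ n = 1) : Finite f.range := by
  obtain ⟨g, m, -, h, -⟩ := hX.exists_generator f hn hf
  have : Finite (Subgroup.zpowers (f g)) :=
    (isOfFinOrder_iff_pow_eq_one.mpr ⟨n, hn, hf g⟩).finite_zpowers
  refine Set.Finite.subset (Set.toFinite (Subgroup.zpowers (f g) : Set G)) ?_
  rintro _ ⟨x, rfl⟩
  obtain ⟨k, hk⟩ := h x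
  exact ⟨k, hk.symm⟩

theorem LocallyCyclic.isCyclic_range {X G : Type u} [Group X] [Group G] (hX : LocallyCyclic X)
    (f : X →* G) {n : ℕ} (hn : 0 < n) (hf : ∀ x, f x ^ n = 1) : IsCyclic f.range := by
  obtain ⟨g, m, -, h, -⟩ := hX.exists_generator f hn hf
  refine ⟨⟨f g, g, rfl⟩, ?_⟩
  rintro ⟨_, x, rfl⟩
  obtain ⟨k, hk⟩ := h x
  exact ⟨k, Subtype.ext (by simpa using hk.symm)⟩

end LocallyCyclic

section Words

variable {C : GroupClass.{u}} {B : Type u} [Group B] {H K : Subgroup B} {φ : H ≃* K}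

/-- The product of a word in the stable letter, without the leading element of `B`. -/
def wordProd (φ : H ≃* K) (l : List (ℤˣ × B)) : HNNExtension B H K φ :=
  (l.map fun x => HNNExtension.t ^ (x.1 : ℤ) * HNNExtension.of x.2).prod

@[simp]
theorem wordProd_nil : wordProd φ [] = 1 := rfl

@[simp]
theorem wordProd_cons (x : ℤˣ × B) (l : List (ℤˣ × B)) :
    wordProd φ (x :: l) = HNNExtension.t ^ (x.1 : ℤ) * HNNExtension.of x.2 * wordProd φ l := by
  simp [wordProd]

/-- No letter of the word is followed by its inverse across an element of the associated
subgroup. -/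
abbrev ReducedList (H K : Subgroup B) (l : List (ℤˣ × B)) : Prop :=
  l.IsChain fun a b => a.2 ∈ HNNExtension.toSubgroup H K a.1 → a.1 = b.1

theorem exists_reducedList (e : HNNExtension B H K φ) :
    ∃ (b : B) (l : List (ℤˣ × B)), ReducedList H K l ∧ e = HNNExtension.of b * wordProd φ l := by
  obtain ⟨d⟩ := HNNExtension.NormalWord.TransversalPair.nonempty B H K
  refine ⟨(HNNExtension.NormalWord.equiv φ d e).head, (HNNExtension.NormalWord.equiv φ d e).toList,
    (HNNExtension.NormalWord.equiv φ d e).chain, ?_⟩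
  exact ((HNNExtension.NormalWord.equiv φ d).symm_apply_apply e).symm

/-- The values of the function attached to a letter `t ^ u`, for a function `δ` attached to `t`. -/
def letterValue {G P : Type*} [Group G] [Group P] (δ : G → P) (g : G) (u : ℤˣ) (z : G) : P :=
  if u = 1 then δ z else (δ (g * z))⁻¹

section Shift

variable {G P : Type*} [Group G] [Group P] (σ : HNNExtension B H K φ →* G) (δ : G → P)
  (hδ : ∀ k ∈ K, ∀ z, δ (σ (HNNExtension.of k) * z) = δ z)

/-- The homomorphism to the wreath product that extends `σ` and sends `t` to `(δ, σ t)`. -/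
noncomputable def shiftHom : HNNExtension B H K φ →* (G → P) ⋊[twistedShift 1] G :=
  HNNExtension.lift (SemidirectProduct.inr.comp (σ.comp HNNExtension.of)) ⟨δ, σ HNNExtension.t⟩ (by
    intro h
    have hr := congrArg σ (HNNExtension.t_mul_of (φ := φ) h)
    simp only [map_mul] at hr
    ext z
    · have := hδ _ (K.inv_mem (φ h).2) z
      simp only [map_inv] at this
      simp [SemidirectProduct.mul_left, this]
    · simpa [SemidirectProduct.mul_right] using hr)

@[simp]
theorem shiftHom_of (b : B) : shiftHom σ δ hδ (HNNExtension.of b) =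
    SemidirectProduct.inr (σ (HNNExtension.of b)) := by
  simp [shiftHom]

@[simp]
theorem shiftHom_right (e : HNNExtension B H K φ) : (shiftHom σ δ hδ e).right = σ e := by
  have : SemidirectProduct.rightHom.comp (shiftHom σ δ hδ) = σ := by
    ext
    · simp
    · simp [shiftHom]
  exact DFunLike.congr_fun this e

theorem shiftHom_wordProd_cons_left (x : ℤˣ × B) (l : List (ℤˣ × B)) (z : G) :
    (shiftHom σ δ hδ (wordProd φ (x :: l))).left z =
      letterValue δ (σ HNNExtension.t) x.1 z * (shiftHom σ δ hδ (wordProd φ l)).left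
        ((σ (HNNExtension.t ^ (x.1 : ℤ) * HNNExtension.of x.2))⁻¹ * z) := by
  rw [wordProd_cons, map_mul, SemidirectProduct.mul_left, Pi.mul_apply, twistedShift_apply,
    shiftHom_right]
  congr 1
  rw [map_mul, SemidirectProduct.mul_left, shiftHom_of]
  rcases Int.units_eq_one_or x.1 with h | h
  · simp [h, letterValue, shiftHom]
  · simp [h, letterValue, shiftHom, SemidirectProduct.inv_left]

theorem shiftHom_wordProd_left_eq_one (l : List (ℤˣ × B)) (z : G)
    (h : ∀ l₁ x l₂, l = l₁ ++ x :: l₂ →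
      letterValue δ (σ HNNExtension.t) x.1 ((σ (wordProd φ l₁))⁻¹ * z) = 1) :
    (shiftHom σ δ hδ (wordProd φ l)).left z = 1 := by
  induction l generalizing z with
  | nil => simp
  | cons x l ih =>
    rw [shiftHom_wordProd_cons_left, ih, mul_one]
    · simpa using h [] x l rfl
    · rintro l₁ y l₂ rfl
      have := h (x :: l₁) y l₂ rfl
      rwa [wordProd_cons, map_mul, mul_inv_rev, mul_assoc] at this

end Shift

/-- If the image of a word under `σ` escapes the base group only because of the words obtained
from it by deletion of letters, then the wreath product distinguishes it from the base group. -/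
theorem IsRootClass.exists_mem_of_reducedList (hC : IsRootClass C)
    (hsep : ∀ (u : ℤˣ) (b : B), b ∉ HNNExtension.toSubgroup H K u →
      ∃ N, inCStar C (HNNExtension B H K φ) N ∧
        ∀ h ∈ HNNExtension.toSubgroup H K u, HNNExtension.of (h⁻¹ * b) ∉ N)
    (l : List (ℤˣ × B)) (hl : ReducedList H K l) (hne : l ≠ []) :
    ∃ N, inCStar C (HNNExtension B H K φ) N ∧
      ∀ b : B, HNNExtension.of b * wordProd φ l ∉ N := by
  classical
  induction hn : l.length using Nat.strong_induction_on generalizing l with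
  | _ n ih =>
  subst hn
  obtain _ | ⟨⟨u, b₁⟩, l⟩ := l
  · exact absurd rfl hne
  obtain ⟨N₁, hN₁, hp⟩ := hC.exists_mem_forall (X := HNNExtension B H K φ)
    (s := {m | m ∈ ((u, b₁) :: l).inits ++ l.inits ∧ m ≠ [] ∧ m.length < ((u, b₁) :: l).length})
    (Set.Finite.subset (List.finite_toSet _) fun m hm => hm.1)
    (fun m N => ∀ b : B, HNNExtension.of b * wordProd φ m ∉ N)
    (fun i N N' h hi b hb => hi b (h hb)) (by
      rintro m ⟨hm, hm', hlt⟩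
      refine ih _ hlt m ?_ hm' rfl
      rcases List.mem_append.mp hm with hm | hm
      · exact List.IsChain.prefix hl ((List.mem_inits _ _).mp hm)
      · exact List.IsChain.prefix hl.tail ((List.mem_inits _ _).mp hm))
  obtain ⟨N₂, hN₂, hb₁⟩ : ∃ N, inCStar C (HNNExtension B H K φ) N ∧
      (b₁ ∉ HNNExtension.toSubgroup H K u →
        ∀ h ∈ HNNExtension.toSubgroup H K u, HNNExtension.of (h⁻¹ * b₁) ∉ N) := by
    by_cases h : b₁ ∈ HNNExtension.toSubgroup H K u
    · exact ⟨⊤, hC.top_mem _, fun h' => absurd h h'⟩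
    · obtain ⟨N, hN, h'⟩ := hsep u b₁ h
      exact ⟨N, hN, fun _ => h'⟩
  obtain ⟨hN, hG⟩ := hC.inf_mem hN₁ hN₂
  set σ := QuotientGroup.mk' (N₁ ⊓ N₂)
  have hker : ∀ e, σ e = 1 → e ∈ N₁ ∧ e ∈ N₂ := fun e he => by
    simpa [σ, Subgroup.mem_inf] using he
  obtain ⟨P, _, hP, _⟩ := hC.2.1
  obtain ⟨a, ha⟩ := exists_ne (1 : P)
  let KG : Subgroup (HNNExtension B H K φ ⧸ (N₁ ⊓ N₂)) := K.map (σ.comp HNNExtension.of)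
  let δ : HNNExtension B H K φ ⧸ (N₁ ⊓ N₂) → P := fun z => if z ∈ KG then a else 1
  have hδ : ∀ k ∈ K, ∀ z, δ (σ (HNNExtension.of k) * z) = δ z := fun k hk z => by
    have : σ (HNNExtension.of k) ∈ KG := ⟨k, hk, rfl⟩
    simp only [δ, KG.mul_mem_cancel_left this]
  have hF : ∀ v z, letterValue δ (σ HNNExtension.t) v z ≠ 1 →
      (v = 1 ∧ ∃ k : K, z = σ (HNNExtension.of (k : B))) ∨
      (v = -1 ∧ ∃ k : K, σ HNNExtension.t * z = σ (HNNExtension.of (k : B))) := by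
    intro v z hv
    have aux : ∀ z, δ z ≠ 1 → ∃ k : K, z = σ (HNNExtension.of (k : B)) := by
      intro z hz
      by_cases h : z ∈ KG
      · obtain ⟨k, hk, rfl⟩ := h
        exact ⟨⟨k, hk⟩, rfl⟩
      · simp [δ, h] at hz
    rcases Int.units_eq_one_or v with rfl | rfl
    · exact Or.inl ⟨rfl, aux _ (by simpa [letterValue] using hv)⟩
    · exact Or.inr ⟨rfl, aux _ (by simpa [letterValue] using hv)⟩
  have hσt : ∀ h : H, σ HNNExtension.t * σ (HNNExtension.of (h : B)) =
      σ (HNNExtension.of (φ h : B)) * σ HNNExtension.t := fun h => by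
    rw [← map_mul, ← map_mul, HNNExtension.t_mul_of]
  -- proper initial segments do not fall into the image of `B`
  have hpre : ∀ l₁ x l₂, l = l₁ ++ x :: l₂ → ∀ b : B,
      σ (wordProd φ ((u, b₁) :: l₁)) ≠ σ (HNNExtension.of b) := by
    rintro l₁ x l₂ rfl b hb
    refine hp ((u, b₁) :: l₁) ⟨?_, by simp, by simp⟩ b⁻¹ (hker _ ?_).1
    · refine List.mem_append_left _ ((List.mem_inits _ _).mpr ⟨x :: l₂, by simp⟩)
    · rw [map_mul, hb, ← map_mul, ← map_mul]; simp
  have hmid : ∀ l₁ x l₂, l = l₁ ++ x :: l₂ → x.1 ≠ u → ∀ h ∈ HNNExtension.toSubgroup H K u,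
      σ (HNNExtension.of b₁) * σ (wordProd φ l₁) ≠ σ (HNNExtension.of h) := by
    rintro l₁ x l₂ rfl hx h hh he
    by_cases hl₁ : l₁ = []
    · subst hl₁
      have hb : b₁ ∉ HNNExtension.toSubgroup H K u := fun hb =>
        hx ((List.isChain_cons_cons.mp hl).1 hb).symm
      refine hb₁ hb h hh (hker _ ?_).2
      simp only [wordProd_nil, map_one, mul_one] at he
      rw [map_mul, map_mul, he, ← map_mul, ← map_mul]; simp
    · refine hp l₁ ⟨?_, hl₁, by simp⟩ (h⁻¹ * b₁) (hker _ ?_).1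
      · exact List.mem_append_right _ ((List.mem_inits _ _).mpr ⟨x :: l₂, by simp⟩)
      · rw [map_mul, map_mul, map_mul, mul_assoc, he, ← map_mul, ← map_mul]; simp
  obtain ⟨z, hz, hz'⟩ : ∃ z, letterValue δ (σ HNNExtension.t) u z ≠ 1 ∧
      ∀ l₁ x l₂, l = l₁ ++ x :: l₂ → letterValue δ (σ HNNExtension.t) x.1
        ((σ (wordProd φ ((u, b₁) :: l₁)))⁻¹ * z) = 1 := by
    rcases Int.units_eq_one_or u with rfl | rfl
    · refine ⟨1, by simpa [letterValue, δ, KG.one_mem] using ha, fun l₁ x l₂ hll => ?_⟩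
      by_contra hne
      rcases hF _ _ hne with ⟨-, k, hk⟩ | ⟨hx, k, hk⟩
      · refine hpre l₁ x l₂ hll (k : B)⁻¹ ?_
        rw [map_inv, map_inv, ← hk, mul_one, inv_inv]
      · refine hmid l₁ x l₂ hll (by rw [hx]; decide) _ (H.inv_mem (φ.symm k).2) ?_
        have h1 := hσt (φ.symm k)
        rw [φ.apply_symm_apply, ← hk, mul_assoc] at h1
        rw [map_inv, map_inv, mul_left_cancel h1]
        simp only [wordProd_cons, map_mul, Units.val_one, zpow_one]
        group
    · refine ⟨(σ HNNExtension.t)⁻¹, by simpa [letterValue, δ, KG.one_mem] using ha,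
        fun l₁ x l₂ hll => ?_⟩
      by_contra hne
      rcases hF _ _ hne with ⟨hx, k, hk⟩ | ⟨hx, k, hk⟩
      · refine hmid l₁ x l₂ hll (by rw [hx]; decide) _ (K.inv_mem k.2) ?_
        rw [map_inv, map_inv, ← hk]
        simp only [wordProd_cons, map_mul, Units.val_neg, Units.val_one, zpow_neg, zpow_one,
          map_inv]
        group
      · refine hpre l₁ x l₂ hll (φ.symm k : B)⁻¹ ?_
        have h1 := hσt (φ.symm k)
        rw [φ.apply_symm_apply, ← hk, mul_assoc] at h1
        rw [map_inv, map_inv, mul_left_cancel h1]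
        group
  refine ⟨_, hC.ker_mem (shiftHom σ δ hδ) (hC.twisted_wreath hG hP 1), fun b hb => hz ?_⟩
  have hw : shiftHom σ δ hδ (wordProd φ ((u, b₁) :: l)) =
      SemidirectProduct.inr (σ (HNNExtension.of b))⁻¹ := by
    rw [MonoidHom.mem_ker, map_mul, shiftHom_of] at hb
    rw [map_inv]
    exact eq_inv_of_mul_eq_one_right hb
  have h1 := shiftHom_wordProd_cons_left σ δ hδ (u, b₁) l z
  rw [hw, shiftHom_wordProd_left_eq_one, mul_one] at h1
  · simpa using h1.symm
  · intro l₁ x l₂ hll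
    have := hz' l₁ x l₂ hll
    rwa [wordProd_cons, map_mul, mul_inv_rev, mul_assoc] at this

theorem IsRootClass.residually_hnnExtension (hC : IsRootClass C)
    (hbase : ∀ b : B, b ≠ 1 → ∃ N, inCStar C (HNNExtension B H K φ) N ∧ HNNExtension.of b ∉ N)
    (hsep : ∀ (u : ℤˣ) (b : B), b ∉ HNNExtension.toSubgroup H K u →
      ∃ N, inCStar C (HNNExtension B H K φ) N ∧
        ∀ h ∈ HNNExtension.toSubgroup H K u, HNNExtension.of (h⁻¹ * b) ∉ N) :
    Residually C (HNNExtension B H K φ) := by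
  refine hC.residually_iff.mpr fun e he => ?_
  obtain ⟨b, l, hl, rfl⟩ := exists_reducedList e
  by_cases hne : l = []
  · subst hne
    simp only [wordProd_nil, mul_one] at he ⊢
    exact hbase b fun h => he (by simp [h])
  · obtain ⟨N, hN, h⟩ := hC.exists_mem_of_reducedList hsep l hl hne
    exact ⟨N, hN, h b⟩

end Words

section Induced

/-- A map that becomes equivariant for the left multiplication after composition with `f`. -/
theorem MonoidHom.exists_map_mul_eq {S R : Type*} [Group S] [Group R] (f : S →* R) :
    ∃ s : R → S, ∀ b y, f (s (f b * y)) = f b * f (s y) := by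
  let q : R → R := fun y => (Quotient.mk (QuotientGroup.rightRel f.range) y).out
  have hq : ∀ y, ∃ b, f b = y * (q y)⁻¹ := fun y => by
    have := Quotient.mk_out (s := QuotientGroup.rightRel f.range) y
    exact QuotientGroup.rightRel_apply.mp this
  choose s hs using hq
  refine ⟨s, fun b y => ?_⟩
  have : q (f b * y) = q y := by
    refine congrArg Quotient.out (Quotient.sound (QuotientGroup.rightRel_apply.mpr ?_))
    exact ⟨b⁻¹, by simp⟩
  rw [hs, hs, this, mul_assoc]

variable {C : GroupClass.{u}} {B : Type u} [Group B] {H K : Subgroup B} {φ : H ≃* K}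

/-- If a homomorphism `ι` from the kernel of `ρ` on `B` to an abelian group `M` is compatible with
an action of the image of `ρ` on `M`, then `ρ` extends to a homomorphism that induces `ι`
on that kernel. -/
theorem IsRootClass.exists_hom_of_abelian (hC : IsRootClass C) {R M : Type u} [Group R]
    [CommGroup M] (hR : C R) (hM : C M) (ρ : HNNExtension B H K φ →* R) (θ : R →* MulAut M)
    (ι : B → M)
    (hmul : ∀ a a', ρ (HNNExtension.of a) = 1 → ρ (HNNExtension.of a') = 1 →
      ι (a * a') = ι a * ι a')
    (hconj : ∀ b a, ρ (HNNExtension.of a) = 1 →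
      ι (b * a * b⁻¹) = θ (ρ (HNNExtension.of b)) (ι a))
    (hφ : ∀ h : H, ρ (HNNExtension.of (h : B)) = 1 → θ (ρ HNNExtension.t) (ι h) = ι (φ h)) :
    ∃ (G : Type u) (_ : Group G) (σ : HNNExtension B H K φ →* G), C G ∧
      ∀ b, σ (HNNExtension.of b) = 1 ↔ ρ (HNNExtension.of b) = 1 ∧ ι b = 1 := by
  set r : B →* R := ρ.comp HNNExtension.of with hr
  set τ : R := ρ HNNExtension.t
  change ∀ a a', r a = 1 → r a' = 1 → ι (a * a') = ι a * ι a' at hmul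
  change ∀ b a, r a = 1 → ι (b * a * b⁻¹) = θ (r b) (ι a) at hconj
  change ∀ h : H, r h = 1 → θ τ (ι h) = ι (φ h) at hφ
  have hrφ : ∀ h : H, τ * r h = r (φ h) * τ := fun h => by
    have := congrArg ρ (HNNExtension.t_mul_of (φ := φ) h)
    rwa [map_mul, map_mul] at this
  obtain ⟨s, hs⟩ := r.exists_map_mul_eq
  obtain ⟨v, hv⟩ := (r.comp H.subtype).exists_map_mul_eq
  simp only [MonoidHom.comp_apply, Subgroup.coe_subtype] at hv
  let c : B → R → M := fun b y => ι (b * s y * (s (r b * y))⁻¹)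
  have hc : ∀ b b' y, c (b * b') y = θ (r b) (c b' y) * c b (r b' * y) := by
    intro b b' y
    have h1 : ∀ b y, r (b * s y * (s (r b * y))⁻¹) = 1 := fun b y => by
      rw [map_mul, map_mul, map_inv, hs, mul_inv_cancel]
    have h2 := h1 b' y
    simp only [c]
    rw [← hconj b _ (h1 b' y), ← hmul _ _ _ (h1 b _)]
    · congr 1
      rw [map_mul, mul_assoc (r b)]
      group
    · rw [map_mul, map_mul, h1, mul_one, map_inv, mul_inv_cancel]
  have hc1 : ∀ a y, r a = 1 → c a y = ι a := fun a y ha => by simp [c, ha]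
  let d : R → M := fun y =>
    c (φ (v y)) (τ * ((r (v y))⁻¹ * y)) * (θ τ (c (v y) ((r (v y))⁻¹ * y)))⁻¹
  have hθ : ∀ (h : H) m, θ τ (θ (r h) m) = θ (r (φ h)) (θ τ m) := fun h m => by
    rw [← MulAut.mul_apply, ← MulAut.mul_apply, ← map_mul, ← map_mul, hrφ]
  have hd : ∀ (h : H) y, d (r h * y) * θ τ (c h y) = c (φ h) (τ * y) * θ (r (φ h)) (d y) := by
    intro h y
    have hy : (r (v (r h * y)))⁻¹ * (r h * y) = (r (v y))⁻¹ * y := by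
      rw [hv]; group
    obtain ⟨z, hz⟩ : ∃ z : H, v (r h * y) = z * (h * v y) := ⟨v (r h * y) * (h * v y)⁻¹, by group⟩
    have hz1 : r z = 1 := by
      have := hv h y
      rw [hz] at this
      simpa using this
    have hz2 : r (φ z) = 1 := by
      have := hrφ z
      rw [hz1, mul_one] at this
      simpa using this.symm
    have e1 : τ * y = r (φ (v y)) * (τ * ((r (v y))⁻¹ * y)) := by
      rw [← mul_assoc (r _), ← hrφ]; group
    have e2 : y = r (v y) * ((r (v y))⁻¹ * y) := by group
    simp only [d, hy]
    generalize (r (v y))⁻¹ * y = y₀ at *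
    rw [hz]
    simp only [map_mul, Subgroup.coe_mul, hc, map_inv, hθ, hz1, hz2, hc1, map_one, MulAut.one_apply,
      hφ z hz1, ← e1, ← e2]
    generalize θ (r (φ h)) (c (φ (v y)) (τ * y₀)) = X
    generalize θ (r (φ h)) (θ τ (c (v y) y₀)) = W
    rw [mul_right_comm, mul_assoc, mul_inv_rev, mul_inv_rev]
    simp only [mul_assoc, mul_comm X]
    simp [mul_comm, mul_left_comm]
  let f : B →* (R → M) ⋊[twistedShift θ] R :=
    { toFun := fun b => ⟨fun x => c b ((r b)⁻¹ * x), r b⟩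
      map_one' := by
        ext x
        · have := hmul 1 1 (map_one r) (map_one r)
          simpa [c] using this
        · simp
      map_mul' := fun b b' => by
        ext x
        · simp [SemidirectProduct.mul_left, hc, mul_assoc, mul_comm]
        · simp }
  have hf : ∀ b, f b = ⟨fun x => c b ((r b)⁻¹ * x), r b⟩ := fun _ => rfl
  refine ⟨_, inferInstance, HNNExtension.lift f ⟨fun x => d (τ⁻¹ * x), τ⟩ ?_,
    hC.twisted_wreath hR hM θ, fun b => ?_⟩
  · intro h
    rw [hf, hf]
    ext x
    · have := hd h ((r h)⁻¹ * (τ⁻¹ * x))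
      have e : (r h)⁻¹ * (τ⁻¹ * x) = τ⁻¹ * ((r (φ h))⁻¹ * x) := by
        rw [← mul_assoc, ← mul_assoc, ← mul_inv_rev, ← mul_inv_rev, hrφ]
      simp only [SemidirectProduct.mul_left, Pi.mul_apply, twistedShift_apply]
      rw [mul_inv_cancel_left] at this
      rw [this, e, mul_inv_cancel_left]
    · exact hrφ h
  · rw [HNNExtension.lift_of, hf]
    constructor
    · intro h
      have hb : r b = 1 := congrArg SemidirectProduct.right h
      have := congrFun (congrArg SemidirectProduct.left h) 1
      exact ⟨hb, by simpa [hc1 b _ hb] using this⟩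
    · rintro ⟨hb, hι⟩
      replace hb : r b = 1 := hb
      ext x
      · simp [hc1 b _ hb, hι]
      · exact hb

end Induced

section Cyclic

theorem mulAut_mul_comm {X : Type*} [Group X] [IsCyclic X] (α β : MulAut X) :
    α * β = β * α :=
  (IsCyclic.mulAutMulEquiv X).injective (by rw [map_mul, map_mul, _root_.mul_comm])

variable {C : GroupClass.{u}} {B : Type u} [Group B] {H K : Subgroup B} {φ : H ≃* K}

/-- The pointwise action of `P → D` on `P → M` together with the shift action of `P`. -/
def pointwiseAction {P D M : Type*} [Group P] [Group D] [Group M] (ν : D →* MulAut M) :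
    (P → D) ⋊[twistedShift (1 : P →* MulAut D)] P →* MulAut (P → M) :=
  SemidirectProduct.lift
    { toFun := fun F => MulEquiv.piCongrRight fun x => ν (F x)
      map_one' := by ext; simp
      map_mul' := fun F F' => by ext; simp }
    (twistedShift 1) (fun p => by ext F m x; simp [MulAut.conj_apply])

theorem pointwiseAction_inl {P D M : Type*} [Group P] [Group D] [Group M] (ν : D →* MulAut M)
    (F : P → D) (m : P → M) (x : P) :
    pointwiseAction ν (SemidirectProduct.inl F) m x = ν (F x) (m x) := by
  simp [pointwiseAction]

theorem pointwiseAction_inr {P D M : Type*} [Group P] [Group D] [Group M] (ν : D →* MulAut M)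
    (p : P) (m : P → M) (x : P) :
    pointwiseAction ν (SemidirectProduct.inr p) m x = m (p⁻¹ * x) := by
  simp [pointwiseAction]

theorem IsRootClass.exists_hom_of_disjoint (hC : IsRootClass C) (hquot : QuotClosed C)
    [H.Normal] [K.Normal] [IsCyclic H] (hB : C B) (hHK : Disjoint H K) :
    ∃ (G : Type u) (_ : Group G) (σ : HNNExtension B H K φ →* G), C G ∧
      ∀ b, σ (HNNExtension.of b) = 1 ↔ b = 1 := by
  classical
  obtain ⟨P, _, hP, _⟩ := hC.2.1
  obtain ⟨τ, hτ⟩ := exists_ne (1 : P)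
  let _ : CommGroup H := IsCyclic.commGroup
  have hcommH : ∀ h ∈ H, ∀ h' ∈ H, h * h' = h' * h := fun h hh h' hh' =>
    congrArg Subtype.val (_root_.mul_comm (⟨h, hh⟩ : H) ⟨h', hh'⟩)
  have hcommK : ∀ k ∈ K, ∀ k' ∈ K, k * k' = k' * k := fun k hk k' hk' => by
    have := congrArg φ (_root_.mul_comm (φ.symm ⟨k, hk⟩) (φ.symm ⟨k', hk'⟩))
    simpa using congrArg Subtype.val this
  have hcomm : ∀ h ∈ H, ∀ k ∈ K, h * k = k * h := fun h hh k hk =>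
    Subgroup.commute_of_normal_of_disjoint H K inferInstance inferInstance hHK h k hh hk
  have huniq : ∀ (h h' : H) (k k' : K), (h * k : B) = h' * k' → h = h' ∧ k = k' := by
    intro h h' k k' e
    have e1 : ((h' : B)⁻¹ * h) = k' * (k : B)⁻¹ := by
      rw [inv_mul_eq_iff_eq_mul, ← mul_assoc, ← e]; simp
    have e2 : ((h' : B)⁻¹ * h) = 1 := Subgroup.disjoint_def.mp hHK
      (H.mul_mem (H.inv_mem h'.2) h.2) (e1 ▸ K.mul_mem k'.2 (K.inv_mem k.2))
    refine ⟨Subtype.ext (inv_mul_eq_one.mp e2).symm, Subtype.ext ?_⟩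
    exact (mul_inv_eq_one.mp (e1.symm.trans e2)).symm
  let α : B →* MulAut H := MulAut.conjNormal
  let β : B →* MulAut H := (autConjHom φ).comp MulAut.conjNormal
  have hα : ∀ a ∈ H ⊔ K, α a = 1 := by
    suffices H ⊔ K ≤ α.ker from this
    refine sup_le (fun a ha => ?_) fun a ha => ?_
    · ext h
      simp [α, hcommH a ha h h.2]
    · ext h
      simp [α, ← hcomm h h.2 a ha]
  have hβ : ∀ a ∈ H ⊔ K, β a = 1 := by
    suffices H ⊔ K ≤ β.ker from this
    refine sup_le (fun a ha => ?_) fun a ha => ?_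
    · have : (MulAut.conjNormal a : MulAut K) = 1 := by
        ext k
        simp [hcomm a ha k k.2]
      simp [β, MonoidHom.mem_ker, this]
    · have : (MulAut.conjNormal a : MulAut K) = 1 := by
        ext k
        simp [hcommK a ha k k.2]
      simp [β, MonoidHom.mem_ker, this]
  let D := (B ⧸ (H ⊔ K)) × (B ⧸ (H ⊔ K))
  have hD : C D := hC.prod (hquot _ _ hB) (hquot _ _ hB)
  let ν : D →* MulAut H := MonoidHom.noncommCoprod (QuotientGroup.lift _ α hα)
    (QuotientGroup.lift _ β hβ) fun _ _ => mulAut_mul_comm _ _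
  have hν1 : ∀ b : B, ν ((b : B ⧸ (H ⊔ K)), 1) = α b := fun b => by
    change QuotientGroup.lift _ α hα (b : B ⧸ (H ⊔ K)) * QuotientGroup.lift _ β hβ 1 = _
    rw [map_one, mul_one]; rfl
  have hν2 : ∀ b : B, ν (1, (b : B ⧸ (H ⊔ K))) = β b := fun b => by
    change QuotientGroup.lift _ α hα 1 * QuotientGroup.lift _ β hβ (b : B ⧸ (H ⊔ K)) = _
    rw [map_one, one_mul]; rfl
  let f₀ : B →* (P → D) := MonoidHom.pi fun x =>
    if x = 1 then (MonoidHom.inl _ _).comp (QuotientGroup.mk' _)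
    else if x = τ then (MonoidHom.inr _ _).comp (QuotientGroup.mk' _) else 1
  have hf1 : ∀ b, f₀ b 1 = ((b : B ⧸ (H ⊔ K)), 1) := fun b => by
    rw [MonoidHom.pi_apply, if_pos rfl]; rfl
  have hfτ : ∀ b, f₀ b τ = (1, (b : B ⧸ (H ⊔ K))) := fun b => by
    rw [MonoidHom.pi_apply, if_neg hτ, if_pos rfl]; rfl
  have hfx : ∀ b x, x ≠ 1 → x ≠ τ → f₀ b x = 1 := fun b x h h' => by
    rw [MonoidHom.pi_apply, if_neg h, if_neg h']; rfl
  have hf₀ : ∀ b, f₀ b = 1 ↔ b ∈ H ⊔ K := by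
    refine fun b => ⟨fun h => ?_, fun h => ?_⟩
    · have := congrFun h 1
      rw [hf1] at this
      exact (QuotientGroup.eq_one_iff b).mp (congrArg Prod.fst this)
    · have hb : ((b : B ⧸ (H ⊔ K))) = 1 := (QuotientGroup.eq_one_iff b).mpr h
      ext1 x
      by_cases h1 : x = 1
      · rw [h1, hf1, hb]; rfl
      · by_cases h2 : x = τ
        · rw [h2, hfτ, hb]; rfl
        · exact hfx b x h1 h2
  let f : B →* (P → D) ⋊[twistedShift (1 : P →* MulAut D)] P := SemidirectProduct.inl.comp f₀
  have hf : ∀ b, f b = 1 ↔ b ∈ H ⊔ K := fun b => by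
    rw [← hf₀, MonoidHom.comp_apply, map_eq_one_iff _ SemidirectProduct.inl_injective]
  let ρ : HNNExtension B H K φ →* (P → D) ⋊[twistedShift (1 : P →* MulAut D)] P :=
    HNNExtension.lift f (SemidirectProduct.inr τ) fun h => by
      rw [(hf _).mpr (Subgroup.mem_sup_left h.2), (hf _).mpr (Subgroup.mem_sup_right (φ h).2),
        one_mul, mul_one]
  have hρ : ∀ b, ρ (HNNExtension.of b) = 1 ↔ b ∈ H ⊔ K := fun b => by
    rw [← hf]; simp [ρ]
  have hdec : ∀ b, ∃ (h : H) (k : K), b ∈ H ⊔ K → b = h * k := fun b => by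
    by_cases hb : b ∈ H ⊔ K
    · obtain ⟨h, hh, k, hk, rfl⟩ := Subgroup.mem_sup_of_normal_left.mp hb
      exact ⟨⟨h, hh⟩, ⟨k, hk⟩, fun _ => rfl⟩
    · exact ⟨1, 1, fun h => absurd h hb⟩
  choose pH pK hp using hdec
  have hpu : ∀ (b : B) (h : H) (k : K), b = h * k → pH b = h ∧ pK b = k := fun b h k hb =>
    huniq _ _ _ _ ((hp b (hb ▸ Subgroup.mul_mem_sup h.2 k.2)).symm.trans hb)
  let ι : B → P → H := fun b x => if x = 1 then pH b else if x = τ then φ.symm (pK b) else 1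
  obtain ⟨G, _, σ, hG, hσ⟩ := hC.exists_hom_of_abelian (hC.twisted_wreath hP hD 1)
    (hC.power hP (hC.2.2.1 _ H hB)) ρ (pointwiseAction ν) ι (fun a a' ha ha' => by
      rw [hρ] at ha ha'
      obtain ⟨h1, h2⟩ := hpu (a * a') (pH a * pH a') (pK a * pK a') (by
        conv_lhs => rw [hp a ha, hp a' ha']
        have := hcomm (pH a') (pH a').2 (pK a) (pK a).2
        simp only [Subgroup.coe_mul, mul_assoc]
        rw [← mul_assoc (pK a : B), ← this, mul_assoc])
      ext1 x
      by_cases hx : x = 1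
      · simp [ι, hx, h1]
      · by_cases hx' : x = τ <;> simp [ι, hx, hx', h2, hτ])
    (fun b a ha => by
      rw [hρ] at ha
      obtain ⟨h1, h2⟩ := hpu (b * a * b⁻¹) (MulAut.conjNormal b (pH a))
        (MulAut.conjNormal b (pK a)) (by
          conv_lhs => rw [hp a ha]
          simp only [MulAut.conjNormal_apply]
          group)
      have hρb : ρ (HNNExtension.of b) = SemidirectProduct.inl (f₀ b) := by simp [ρ, f]
      ext1 x
      rw [hρb, pointwiseAction_inl]
      by_cases hx : x = 1
      · simp [ι, hx, h1, hf1, hν1, α]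
      · by_cases hx' : x = τ
        · simp [ι, hx', h2, hτ, hfτ, hν2, β, autConjHom]
        · simp [ι, hx, hx', hfx])
    (fun h _ => by
      have hρt : ρ HNNExtension.t = SemidirectProduct.inr τ := by simp [ρ]
      obtain ⟨h1, h2⟩ := hpu h h 1 (by simp)
      obtain ⟨h3, h4⟩ := hpu (φ h) 1 (φ h) (by simp)
      ext1 x
      rw [hρt, pointwiseAction_inr]
      by_cases hx : x = τ
      · simp [ι, hx, h1, h4, hτ]
      · have : τ⁻¹ * x ≠ 1 := fun e => hx (inv_mul_eq_one.mp e).symm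
        simp [ι, hx, this, h2, h3])
  refine ⟨G, inferInstance, σ, hG, fun b => ?_⟩
  rw [hσ, hρ]
  constructor
  · rintro ⟨hb, hι⟩
    have e1 := congrFun hι 1
    have e2 := congrFun hι τ
    simp only [ι, if_true, Pi.one_apply, hτ, if_false] at e1 e2
    rw [hp b hb, e1, φ.symm.map_eq_one_iff.mp e2]
    simp
  · rintro rfl
    obtain ⟨h1, h2⟩ := hpu 1 1 1 (by simp)
    exact ⟨one_mem _, by ext1 x; simp [ι, h1, h2]⟩

end Cyclic

section Quotients

theorem MulEquiv.exists_of_ker_iff {X Y X' Y' : Type*} [Group X] [Group Y] [Group X'] [Group Y']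
    (e : X ≃* Y) (f : X →* X') (hf : Function.Surjective f) (g : Y →* Y')
    (hg : Function.Surjective g) (h : ∀ x, f x = 1 ↔ g (e x) = 1) :
    ∃ e' : X' ≃* Y', ∀ x, e' (f x) = g (e x) := by
  have hmap : f.ker.map e.toMonoidHom = g.ker := by
    ext y
    simp only [Subgroup.mem_map, MonoidHom.mem_ker, h]
    constructor
    · rintro ⟨x, hx, rfl⟩
      exact hx
    · intro hy
      exact ⟨e.symm y, by simpa using hy, e.apply_symm_apply y⟩
  refine ⟨((QuotientGroup.quotientKerEquivOfSurjective f hf).symm.trans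
    (QuotientGroup.congr _ _ e hmap)).trans (QuotientGroup.quotientKerEquivOfSurjective g hg),
    fun x => ?_⟩
  have : (QuotientGroup.quotientKerEquivOfSurjective f hf).symm (f x) = (x : X ⧸ f.ker) := by
    rw [MulEquiv.symm_apply_eq]; rfl
  simp only [MulEquiv.trans_apply, this]
  rfl

theorem MulAut.zpow_apply_map {X Y : Type*} [Group X] [Group Y] (f : X →* Y) {α : MulAut X}
    {β : MulAut Y} (h : ∀ x, β (f x) = f (α x)) (n : ℤ) (x : X) :
    (β ^ n) (f x) = f ((α ^ n) x) := by
  induction n using Int.induction_on generalizing x with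
  | zero => simp
  | succ n ih => rw [zpow_add_one, zpow_add_one, MulAut.mul_apply, MulAut.mul_apply, h, ih]
  | pred n ih =>
    rw [zpow_sub_one, zpow_sub_one, MulAut.mul_apply, MulAut.mul_apply, ← ih]
    congr 1
    rw [MulAut.inv_apply, MulEquiv.symm_apply_eq, h]
    simp

variable {C : GroupClass.{u}} {B : Type u} [Group B] {H K : Subgroup B} {φ : H ≃* K}
  {ψ : MulAut ↥(H ⊓ K)}

theorem IsRestrictionToL.mem_iff (hψ : IsRestrictionToL H K φ ψ) (h : H) :
    (h : B) ∈ H ⊓ K ↔ (φ h : B) ∈ H ⊓ K := by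
  constructor
  · intro hh
    exact hψ ⟨h, hh⟩ ▸ (ψ ⟨h, hh⟩).2
  · intro hh
    have h1 := hψ (ψ.symm ⟨φ h, hh⟩)
    rw [ψ.apply_symm_apply] at h1
    have h2 := φ.injective (Subtype.ext h1)
    rw [h2]
    exact (ψ.symm ⟨φ h, hh⟩).2

theorem HNNExtension.exists_map_quotient (φ : H ≃* K) (Q : Subgroup B) [Q.Normal]
    (hQ : ∀ h : H, (h : B) ∈ Q ↔ (φ h : B) ∈ Q) :
    ∃ φ' : H.map (QuotientGroup.mk' Q) ≃* K.map (QuotientGroup.mk' Q),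
      (∀ (h : H) (h' : H.map (QuotientGroup.mk' Q)), (h' : B ⧸ Q) = ((h : B) : B ⧸ Q) →
        (φ' h' : B ⧸ Q) = ((φ h : B) : B ⧸ Q)) ∧
      ∃ π : HNNExtension B H K φ →* HNNExtension (B ⧸ Q) _ _ φ',
        ∀ b : B, π (HNNExtension.of b) = HNNExtension.of (b : B ⧸ Q) := by
  obtain ⟨φ', hφ'⟩ := φ.exists_of_ker_iff _ ((QuotientGroup.mk' Q).subgroupMap_surjective H) _
    ((QuotientGroup.mk' Q).subgroupMap_surjective K) (fun h => by
      simpa [Subtype.ext_iff] using hQ h)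
  have key : ∀ (h : H) (h' : H.map (QuotientGroup.mk' Q)), (h' : B ⧸ Q) = ((h : B) : B ⧸ Q) →
      (φ' h' : B ⧸ Q) = ((φ h : B) : B ⧸ Q) := by
    intro h h' e
    obtain rfl : h' = (QuotientGroup.mk' Q).subgroupMap H h := Subtype.ext e
    rw [hφ']
    rfl
  refine ⟨φ', key, HNNExtension.lift (HNNExtension.of.comp (QuotientGroup.mk' Q)) HNNExtension.t
    fun h => ?_, fun b => by simp⟩
  have := HNNExtension.t_mul_of (φ := φ') ⟨(h : B), h, h.2, rfl⟩
  rwa [key h _ rfl] at this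

theorem IsRootClass.exists_hom_injective (hC : IsRootClass C) (hquot : QuotClosed C)
    [H.Normal] [K.Normal] [IsCyclic H] (hB : C B) (hψ : IsRestrictionToL H K φ ψ)
    (hF : C (Subgroup.zpowers ψ)) :
    ∃ (G : Type u) (_ : Group G) (σ : HNNExtension B H K φ →* G), C G ∧
      ∀ b, σ (HNNExtension.of b) = 1 ↔ b = 1 := by
  classical
  obtain ⟨φ', -, π, hπ⟩ := HNNExtension.exists_map_quotient φ (H ⊓ K) hψ.mem_iff
  have hdisj : Disjoint (H.map (QuotientGroup.mk' (H ⊓ K)))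
      (K.map (QuotientGroup.mk' (H ⊓ K))) := by
    rw [Subgroup.disjoint_def]
    rintro _ ⟨h, hh, rfl⟩ ⟨k, hk, e⟩
    have : k⁻¹ * h ∈ H ⊓ K := QuotientGroup.eq.mp e
    have hhK : h ∈ K := (K.mul_mem_cancel_left (K.inv_mem hk)).mp this.2
    exact (QuotientGroup.eq_one_iff h).mpr ⟨hh, hhK⟩
  have : (H.map (QuotientGroup.mk' (H ⊓ K))).Normal :=
    Subgroup.Normal.map inferInstance _ (QuotientGroup.mk'_surjective _)
  have : (K.map (QuotientGroup.mk' (H ⊓ K))).Normal :=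
    Subgroup.Normal.map inferInstance _ (QuotientGroup.mk'_surjective _)
  have : IsCyclic (H.map (QuotientGroup.mk' (H ⊓ K))) :=
    isCyclic_of_surjective _ ((QuotientGroup.mk' (H ⊓ K)).subgroupMap_surjective H)
  obtain ⟨G, _, σ, hG, hσ⟩ := hC.exists_hom_of_disjoint (φ := φ') hquot (hquot B (H ⊓ K) hB) hdisj
  have : IsCyclic ↥(H ⊓ K) :=
    isCyclic_of_injective _ (Subgroup.inclusion_injective (inf_le_left : H ⊓ K ≤ H))
  let _ : CommGroup ↥(H ⊓ K) := IsCyclic.commGroup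
  let ν : HNNExtension B H K φ →* MulAut ↥(H ⊓ K) :=
    HNNExtension.lift MulAut.conjNormal ψ fun h => by
      ext l
      have h1 := hψ (MulAut.conjNormal (h : B) l)
      have h2 : (⟨_, (MulAut.conjNormal (h : B) l).2.1⟩ : H) = h * ⟨l, l.2.1⟩ * h⁻¹ :=
        Subtype.ext (by simp)
      rw [h2, map_mul, map_mul, map_inv] at h1
      simp [h1, hψ l]
  have hν : C ν.range := by
    let κ : (MulAut.conjNormal : B →* MulAut ↥(H ⊓ K)).range × Subgroup.zpowers ψ →*
        MulAut ↥(H ⊓ K) :=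
      MonoidHom.noncommCoprod (Subgroup.subtype _) (Subgroup.subtype _)
        fun _ _ => mulAut_mul_comm _ _
    have hle : ∀ e, ν e ∈ κ.range := by
      intro e
      induction e using HNNExtension.induction_on with
      | of b => exact ⟨(⟨_, b, rfl⟩, 1), (mul_one _).trans (HNNExtension.lift_of MulAut.conjNormal ψ _ b).symm⟩
      | t => exact ⟨(1, ⟨ψ, Subgroup.mem_zpowers ψ⟩), (one_mul _).trans (HNNExtension.lift_t MulAut.conjNormal ψ _).symm⟩
      | mul x y hx hy => rw [map_mul]; exact mul_mem hx hy
      | inv x hx => rw [map_inv]; exact inv_mem hx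
    refine hC.of_injective (Subgroup.inclusion (?_ : ν.range ≤ κ.range))
      (Subgroup.inclusion_injective _) (hC.of_surjective hquot _ κ.rangeRestrict_surjective
        (hC.prod (hC.of_surjective hquot _ (MonoidHom.rangeRestrict_surjective _) hB) hF))
    rintro _ ⟨e, rfl⟩
    exact hle e
  let ι : B → ↥(H ⊓ K) := fun b => if hb : b ∈ H ⊓ K then ⟨b, hb⟩ else 1
  have hι : ∀ b (hb : b ∈ H ⊓ K), ι b = ⟨b, hb⟩ := fun b hb => dif_pos hb
  let ρ := (σ.comp π).prod ν.rangeRestrict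
  have hρ : ∀ b, ρ (HNNExtension.of b) = 1 → b ∈ H ⊓ K := fun b hb => by
    have := congrArg Prod.fst hb
    change σ (π (HNNExtension.of b)) = 1 at this
    rw [hπ, hσ] at this
    exact (QuotientGroup.eq_one_iff b).mp this
  obtain ⟨G', _, σ', hG', hσ'⟩ := hC.exists_hom_of_abelian (M := ↥(H ⊓ K)) (hC.prod hG hν)
    (hC.2.2.1 _ _ hB) ρ (ν.range.subtype.comp (MonoidHom.snd _ _)) ι
    (fun a a' ha ha' => by
      rw [hι a (hρ a ha), hι a' (hρ a' ha'), hι _ (mul_mem (hρ a ha) (hρ a' ha'))]; rfl)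
    (fun b a ha => by
      rw [hι a (hρ a ha), hι _ (Subgroup.Normal.conj_mem inferInstance a (hρ a ha) b)]
      ext
      simp [ρ, ν])
    (fun h hh => by
      rw [hι _ (hρ _ hh), hι _ ((hψ.mem_iff h).mp (hρ _ hh))]
      ext
      simpa [ρ, ν] using hψ ⟨h, hρ _ hh⟩)
  refine ⟨G', inferInstance, σ', hG', fun b => ⟨fun hb => ?_, ?_⟩⟩
  · obtain ⟨h1, h2⟩ := (hσ' b).mp hb
    rw [hι b (hρ b h1)] at h2
    exact congrArg Subtype.val h2
  · rintro rfl
    simp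

/-- A normal subgroup `Q` of `B` with `B/Q` in `C` is cut out on `B` by a homomorphism of the
HNN-extension provided that `Q` is compatible with `φ` and `HQ ∩ KQ = LQ`. -/
theorem IsRootClass.exists_mem_hnnExtension (hC : IsRootClass C) (hper : PeriodicClass C)
    (hquot : QuotClosed C) [H.Normal] [K.Normal] (hH : LocallyCyclic H)
    (hψ : IsRestrictionToL H K φ ψ) (hF : C (Subgroup.zpowers ψ)) {Q : Subgroup B}
    (hQ : inCStar C B Q) (hcomp : ∀ h : H, (h : B) ∈ Q ↔ (φ h : B) ∈ Q)
    (hL : ∀ h ∈ H, ∀ k ∈ K, h⁻¹ * k ∈ Q → ∃ l ∈ H ⊓ K, h⁻¹ * l ∈ Q) :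
    ∃ N, inCStar C (HNNExtension B H K φ) N ∧ ∀ b, HNNExtension.of b ∈ N ↔ b ∈ Q := by
  obtain ⟨_, hBQ⟩ := hQ
  obtain ⟨φ', hφ', π, hπ⟩ := HNNExtension.exists_map_quotient φ Q hcomp
  have : (H.map (QuotientGroup.mk' Q)).Normal :=
    Subgroup.Normal.map inferInstance _ (QuotientGroup.mk'_surjective _)
  have : (K.map (QuotientGroup.mk' Q)).Normal :=
    Subgroup.Normal.map inferInstance _ (QuotientGroup.mk'_surjective _)
  obtain ⟨n, hn, hpow⟩ := hC.exists_pow_eq_one hper hBQ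
  have : IsCyclic (H.map (QuotientGroup.mk' Q)) := by
    have := hH.isCyclic_range ((QuotientGroup.mk' Q).comp H.subtype) hn fun _ => hpow _
    rwa [MonoidHom.range_comp, Subgroup.range_subtype] at this
  let f : ↥(H ⊓ K) →* ↥(H.map (QuotientGroup.mk' Q) ⊓ K.map (QuotientGroup.mk' Q)) :=
    ((QuotientGroup.mk' Q).comp (H ⊓ K).subtype).codRestrict _
      fun l => ⟨⟨l, l.2.1, rfl⟩, ⟨l, l.2.2, rfl⟩⟩
  have hf : Function.Surjective f := by
    rintro ⟨_, ⟨h, hh, rfl⟩, ⟨k, hk, e⟩⟩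
    obtain ⟨l, hl, e'⟩ := hL h hh k hk (QuotientGroup.eq.mp e.symm)
    exact ⟨⟨l, hl⟩, Subtype.ext (QuotientGroup.eq.mpr e').symm⟩
  have hf1 : ∀ l, f l = 1 ↔ (l : B) ∈ Q := fun l => by
    rw [Subtype.ext_iff]; exact QuotientGroup.eq_one_iff _
  obtain ⟨ψ', hψ'⟩ := ψ.exists_of_ker_iff f hf f hf fun l => by
    rw [hf1, hf1, hψ l]
    exact hcomp ⟨l, l.2.1⟩
  have hψ'r : IsRestrictionToL _ _ φ' ψ' := by
    intro x
    obtain ⟨l, rfl⟩ := hf x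
    rw [hψ' l, hφ' ⟨l, l.2.1⟩ _ rfl, ← hψ l]
    rfl
  obtain ⟨G, _, σ, hG, hσ⟩ := hC.exists_hom_injective hquot hBQ hψ'r
    (hC.zpowers_of_zpow_eq_one hquot (fun n hn => by
      ext x
      obtain ⟨l, rfl⟩ := hf x
      rw [MulAut.zpow_apply_map f (α := ψ) (β := ψ') hψ', hn]
      rfl) hF)
  refine ⟨_, hC.ker_mem (σ.comp π) hG, fun b => ?_⟩
  rw [MonoidHom.mem_ker, MonoidHom.comp_apply, hπ, hσ, QuotientGroup.eq_one_iff]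

end Quotients

section Sufficiency

variable {C : GroupClass.{u}}

theorem LocallyCyclic.of_injective {X Y : Type u} [Group X] [Group Y] (hX : LocallyCyclic X)
    (f : Y →* X) (hf : Function.Injective f) : LocallyCyclic Y := fun S hS =>
  have := hX (S.map f) ((Subgroup.fg_iff_submonoid_fg _).mpr
    (((Subgroup.fg_iff_submonoid_fg S).mp hS).map f))
  isCyclic_of_surjective _ (S.equivMapOfInjective f hf).symm.surjective

theorem LocallyCyclic.normal_map_ker {X G : Type u} [Group X] [Group G] {Y : Subgroup X}
    [Y.Normal] (hY : LocallyCyclic Y) (f : Y →* G) {n : ℕ} (hn : 0 < n) (hf : ∀ x, f x ^ n = 1) :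
    (f.ker.map Y.subtype).Normal := by
  refine ⟨?_⟩
  rintro _ ⟨y, hy, rfl⟩ x
  exact ⟨MulAut.conjNormal x y, (hY.map_mulAut_eq_one_iff f hn hf (MulAut.conjNormal x) y).mpr hy,
    by simp⟩

theorem IsRootClass.comap_mem (hC : IsRootClass C) {X Y : Type u} [Group X] [Group Y]
    (f : X →* Y) {N : Subgroup Y} (hN : inCStar C Y N) : inCStar C X (N.comap f) := by
  obtain ⟨_, hN⟩ := hN
  have := hC.ker_mem ((QuotientGroup.mk' N).comp f) hN
  rwa [← MonoidHom.comap_ker, QuotientGroup.ker_mk'] at this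

theorem IsRootClass.mem_of_le (hC : IsRootClass C) (hquot : QuotClosed C) {X : Type u} [Group X]
    {N N' : Subgroup X} [N'.Normal] (hN : inCStar C X N) (h : N ≤ N') : inCStar C X N' := by
  obtain ⟨_, hN⟩ := hN
  exact ⟨inferInstance, hC.of_surjective hquot (QuotientGroup.map N N' (MonoidHom.id X) h)
    (QuotientGroup.map_surjective_of_surjective _ _ _
      ((QuotientGroup.mk'_surjective N').comp Function.surjective_id) h) hN⟩

theorem IsRootClass.sup (hC : IsRootClass C) (hquot : QuotClosed C) {X : Type u} [Group X]
    {S T : Subgroup X} [S.Normal] (hS : C S) (hT : C T) : C ↥(S ⊔ T) :=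
  hC.of_sup_eq_top hquot (S := S.subgroupOf (S ⊔ T)) (T := T.subgroupOf (S ⊔ T))
    (by rw [← Subgroup.subgroupOf_sup le_sup_left le_sup_right, Subgroup.subgroupOf_self])
    (hC.1 _ _ (Subgroup.subgroupOfEquivOfLe le_sup_left).symm hS)
    (hC.1 _ _ (Subgroup.subgroupOfEquivOfLe le_sup_right).symm hT)

variable {B : Type u} [Group B] {H K : Subgroup B} {φ : H ≃* K} {ψ : MulAut ↥(H ⊓ K)}

theorem IsRootClass.residually_hnnExtension_of_forall_exists (hC : IsRootClass C)
    (hper : PeriodicClass C) (hquot : QuotClosed C) [H.Normal] [K.Normal] (hH : LocallyCyclic H)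
    (hψ : IsRestrictionToL H K φ ψ) (hF : C (Subgroup.zpowers ψ)) (hB : Residually C B)
    (hBH : Residually C (B ⧸ H)) (hBK : Residually C (B ⧸ K))
    (h : ∀ N, inCStar C B N → ∃ Q, inCStar C B Q ∧ Q ≤ N ∧
      (∀ h : H, (h : B) ∈ Q ↔ (φ h : B) ∈ Q) ∧
      ∀ h ∈ H, ∀ k ∈ K, h⁻¹ * k ∈ Q → ∃ l ∈ H ⊓ K, h⁻¹ * l ∈ Q) :
    Residually C (HNNExtension B H K φ) := by
  have key : ∀ N, inCStar C B N →
      ∃ N', inCStar C (HNNExtension B H K φ) N' ∧ ∀ b, HNNExtension.of b ∈ N' → b ∈ N := by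
    intro N hN
    obtain ⟨Q, hQ, hle, hcomp, hL⟩ := h N hN
    obtain ⟨N', hN', hiff⟩ := hC.exists_mem_hnnExtension hper hquot hH hψ hF hQ hcomp hL
    exact ⟨N', hN', fun b hb => hle ((hiff b).mp hb)⟩
  refine hC.residually_hnnExtension (fun b hb => ?_) fun u b hb => ?_
  · obtain ⟨N, hN, hbN⟩ := hC.residually_iff.mp hB b hb
    obtain ⟨N', hN', hle⟩ := key N hN
    exact ⟨N', hN', fun h => hbN (hle b h)⟩
  · obtain ⟨N, hN, hle, hbN⟩ : ∃ N, inCStar C B N ∧ HNNExtension.toSubgroup H K u ≤ N ∧ b ∉ N := by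
      rcases Int.units_eq_one_or u with rfl | rfl
      · exact (hC.residually_quotient_iff H).mp hBH b hb
      · exact (hC.residually_quotient_iff K).mp hBK b hb
    obtain ⟨N', hN', hle'⟩ := key N hN
    exact ⟨N', hN', fun h hh hmem =>
      hbN ((N.mul_mem_cancel_left (N.inv_mem (hle hh))).mp (hle' _ hmem))⟩

theorem IsRestrictionToL.relIndex_eq (hψ : IsRestrictionToL H K φ ψ) :
    (H ⊓ K).relIndex K = (H ⊓ K).relIndex H := by
  have : ((H ⊓ K).subgroupOf K).comap φ.toMonoidHom = (H ⊓ K).subgroupOf H := by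
    ext h
    exact (hψ.mem_iff h).symm
  rw [Subgroup.relIndex, Subgroup.relIndex, ← this]
  exact (Subgroup.index_comap_of_surjective _ φ.surjective).symm

theorem IsRootClass.relIndex_ne_zero (hC : IsRootClass C) (hper : PeriodicClass C)
    (hH : LocallyCyclic H) {N : Subgroup B} (hN : inCStar C B N) : N.relIndex H ≠ 0 := by
  obtain ⟨_, hN⟩ := hN
  obtain ⟨n, hn, hpow⟩ := hC.exists_pow_eq_one hper hN
  have := hH.finite_range ((QuotientGroup.mk' N).comp H.subtype) hn fun _ => hpow _
  rw [MonoidHom.range_comp, Subgroup.range_subtype] at this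
  rw [← QuotientGroup.ker_mk' N, Subgroup.relIndex_ker]
  exact Nat.card_pos.ne'

theorem IsRootClass.residually_hnnExtension_of_finite_quotient (hC : IsRootClass C)
    (hper : PeriodicClass C) (hquot : QuotClosed C) [H.Normal] [K.Normal] (hH : LocallyCyclic H)
    (hK : LocallyCyclic K) (hψ : IsRestrictionToL H K φ ψ) (hF : C (Subgroup.zpowers ψ))
    (hfin : Finite (↥H ⧸ (H ⊓ K).subgroupOf H)) (hB : Residually C B)
    (hBH : Residually C (B ⧸ H)) (hBK : Residually C (B ⧸ K)) :
    Residually C (HNNExtension B H K φ) := by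
  refine hC.residually_hnnExtension_of_forall_exists hper hquot hH hψ hF hB hBH hBK fun N hN => ?_
  have hLH : (H ⊓ K).relIndex H ≠ 0 := Subgroup.index_ne_zero_of_finite
  have hLK : (H ⊓ K).relIndex K ≠ 0 := hψ.relIndex_eq ▸ hLH
  obtain ⟨_, hBN⟩ := id hN
  set M := N ⊓ (H ⊓ K)
  have hMK : M.relIndex (H ⊔ K) ≠ 0 := by
    rw [← Subgroup.relIndex_mul_relIndex M K (H ⊔ K) (inf_le_right.trans inf_le_right)
      le_sup_right, Subgroup.relIndex_sup_right, ← Subgroup.inf_relIndex_left H K]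
    exact mul_ne_zero (Subgroup.relIndex_inf_ne_zero (hC.relIndex_ne_zero hper hK hN) hLK) hLH
  have : Finite ((H ⊔ K).map (QuotientGroup.mk' M)) := by
    rw [← QuotientGroup.ker_mk' M, Subgroup.relIndex_ker] at hMK
    exact Nat.finite_of_card_ne_zero hMK
  have hBM : Residually C (B ⧸ M) := by
    refine (hC.residually_quotient_iff M).mpr fun x hx => ?_
    by_cases hxN : x ∈ N
    · by_cases hxH : x ∈ H
      · obtain ⟨N', hN', hle, hxN'⟩ := (hC.residually_quotient_iff K).mp hBK x
          fun hxK => hx ⟨hxN, hxH, hxK⟩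
        exact ⟨N', hN', (inf_le_right.trans inf_le_right).trans hle, hxN'⟩
      · obtain ⟨N', hN', hle, hxN'⟩ := (hC.residually_quotient_iff H).mp hBH x hxH
        exact ⟨N', hN', (inf_le_right.trans inf_le_left).trans hle, hxN'⟩
    · exact ⟨N, hN, inf_le_left, hxN⟩
  obtain ⟨N', hN', hbot⟩ := hC.exists_mem_inf_eq_bot hBM ((H ⊔ K).map (QuotientGroup.mk' M))
  have hQ : ∀ x ∈ H ⊔ K, x ∈ N'.comap (QuotientGroup.mk' M) ⊓ N ↔ x ∈ M := by
    refine fun x hx => ⟨fun h => ?_, fun h => ⟨?_, h.1⟩⟩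
    · exact (QuotientGroup.eq_one_iff x).mp
        ((Subgroup.eq_bot_iff_forall _).mp hbot _ ⟨h.1, x, hx, rfl⟩)
    · change (x : B ⧸ M) ∈ N'
      rw [(QuotientGroup.eq_one_iff x).mpr h]
      exact N'.one_mem
  refine ⟨_, hC.inf_mem (hC.comap_mem (QuotientGroup.mk' M) hN') hN, inf_le_right, fun h => ?_,
    fun h hh k hk hmem => ?_⟩
  · rw [hQ _ (le_sup_left (a := H) h.2), hQ _ (le_sup_right (a := H) (φ h).2)]
    obtain ⟨n, hn, hpow⟩ := hC.exists_pow_eq_one hper hBN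
    have hinv (l : ↥(H ⊓ K)) : ((ψ l : ↥(H ⊓ K)) : B) ∈ N ↔ (l : B) ∈ N := by
      simpa using (hH.of_injective _ (Subgroup.inclusion_injective
        (inf_le_left : H ⊓ K ≤ H))).map_mulAut_eq_one_iff
          ((QuotientGroup.mk' N).comp (H ⊓ K).subtype) hn (fun _ => hpow _) ψ l
    constructor
    · rintro ⟨h1, h2⟩
      exact ⟨hψ ⟨h, h2⟩ ▸ (hinv ⟨h, h2⟩).mpr h1, (hψ.mem_iff h).mp h2⟩
    · rintro ⟨h1, h2⟩
      have h3 := (hψ.mem_iff h).mpr h2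
      exact ⟨(hinv ⟨h, h3⟩).mp ((hψ ⟨h, h3⟩).symm ▸ h1), h3⟩
  · have hhk := ((hQ _ (mul_mem (inv_mem (le_sup_left (a := H) hh))
      (le_sup_right (a := H) hk))).mp hmem).2.1
    exact ⟨k, ⟨(H.mul_mem_cancel_left (H.inv_mem hh)).mp hhk, hk⟩, hmem⟩

theorem IsRootClass.residually_hnnExtension_of_quasiRegular (hC : IsRootClass C)
    (hper : PeriodicClass C) (hquot : QuotClosed C) [H.Normal] [K.Normal] (hH : LocallyCyclic H)
    (hK : LocallyCyclic K) (hψ : IsRestrictionToL H K φ ψ) (hF : C (Subgroup.zpowers ψ))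
    [Finite ↥(H ⊓ K)] (hreg : QuasiRegular C B (H ⊔ K)) (hB : Residually C B)
    (hBH : Residually C (B ⧸ H)) (hBK : Residually C (B ⧸ K)) :
    Residually C (HNNExtension B H K φ) := by
  refine hC.residually_hnnExtension_of_forall_exists hper hquot hH hψ hF hB hBH hBK fun N' hN' => ?_
  obtain ⟨N, hN, hle, hbot⟩ : ∃ N, inCStar C B N ∧ N ≤ N' ∧ ∀ x ∈ N, x ∈ H → x ∈ K → x = 1 := by
    obtain ⟨N, hN, hbot⟩ := hC.exists_mem_inf_eq_bot hB (H ⊓ K)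
    exact ⟨_, hC.inf_mem hN' hN, inf_le_left, fun x hx hxH hxK =>
      (Subgroup.eq_bot_iff_forall _).mp hbot x ⟨hx.2, hxH, hxK⟩⟩
  obtain ⟨_, hBN⟩ := id hN
  obtain ⟨n, hn, hpow⟩ := hC.exists_pow_eq_one hper (hC.prod hBN hBN)
  let f : H →* (B ⧸ N) × (B ⧸ N) := ((QuotientGroup.mk' N).comp H.subtype).prod
    ((QuotientGroup.mk' N).comp (K.subtype.comp φ.toMonoidHom))
  have hf (h : H) : f h = 1 ↔ (h : B) ∈ N ∧ (φ h : B) ∈ N := by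
    simp [f, Prod.ext_iff]
  let g : K →* (B ⧸ N) × (B ⧸ N) := f.comp φ.symm.toMonoidHom
  set H' := f.ker.map H.subtype
  set K' := g.ker.map K.subtype
  have hH'H : H' ≤ H := Subgroup.map_subtype_le _
  have hK'K : K' ≤ K := Subgroup.map_subtype_le _
  have hH'N : H' ≤ N := by
    rintro _ ⟨h, hh, rfl⟩
    exact ((hf h).mp hh).1
  have hK'N : K' ≤ N := by
    rintro _ ⟨k, hk, rfl⟩
    have := ((hf _).mp hk).2
    rwa [MulEquiv.coe_toMonoidHom, φ.apply_symm_apply] at this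
  have hH' (h : H) : (h : B) ∈ H' ↔ f h = 1 := by
    simp [H', MonoidHom.mem_ker]
  have hK' (h : H) : (φ h : B) ∈ K' ↔ f h = 1 := by
    have : g (φ h) = f h := congrArg f (φ.symm_apply_apply h)
    rw [← this]
    simp [K', MonoidHom.mem_ker]
  have : H'.Normal := hH.normal_map_ker f hn fun _ => hpow _
  have : K'.Normal := hK.normal_map_ker g hn fun _ => hpow _
  set M := H' ⊔ K'
  have hMH (x : B) (hx : x ∈ M) (hxH : x ∈ H) : x ∈ H' := by
    obtain ⟨h, hh, k, hk, rfl⟩ := Subgroup.mem_sup_of_normal_left.mp hx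
    have hkH := (H.mul_mem_cancel_left (hH'H hh)).mp hxH
    rwa [hbot k (hK'N hk) hkH (hK'K hk), mul_one]
  have hMK (x : B) (hx : x ∈ M) (hxK : x ∈ K) : x ∈ K' := by
    obtain ⟨h, hh, k, hk, rfl⟩ := Subgroup.mem_sup_of_normal_left.mp hx
    have hhK := (K.mul_mem_cancel_right (hK'K hk)).mp hxK
    rwa [hbot h (hH'N hh) (hH'H hh) hhK, one_mul]
  have hMC : inCStar C ↥(H ⊔ K) (M.subgroupOf (H ⊔ K)) := by
    have : (H.map (QuotientGroup.mk' M)).Normal :=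
      Subgroup.Normal.map inferInstance _ (QuotientGroup.mk'_surjective _)
    have h1 : C (H.map (QuotientGroup.mk' M)) := by
      have := hC.range_of_ker_le hquot f ((QuotientGroup.mk' M).comp H.subtype)
        (fun h hh => (QuotientGroup.eq_one_iff _).mpr (le_sup_left (a := H') ((hH' h).mpr hh)))
        (hC.prod hBN hBN)
      rwa [MonoidHom.range_comp, Subgroup.range_subtype] at this
    have h2 : C (K.map (QuotientGroup.mk' M)) := by
      have := hC.range_of_ker_le hquot g ((QuotientGroup.mk' M).comp K.subtype)
        (fun k hk => (QuotientGroup.eq_one_iff _).mpr (le_sup_right (a := H') ⟨k, hk, rfl⟩))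
        (hC.prod hBN hBN)
      rwa [MonoidHom.range_comp, Subgroup.range_subtype] at this
    have h3 := hC.sup hquot h1 h2
    rw [← Subgroup.map_sup] at h3
    have := hC.ker_mem ((QuotientGroup.mk' M).subgroupMap (H ⊔ K)) h3
    convert this using 1
    ext x
    simp [Subgroup.mem_subgroupOf, MonoidHom.mem_ker, Subtype.ext_iff]
  obtain ⟨Q, hQ, hQM⟩ := hreg _ hMC
  obtain ⟨_, -⟩ := id hQ
  have hmem (x : B) (hx : x ∈ H ⊔ K) : x ∈ (Q ⊓ N) ⊔ M ↔ x ∈ M := by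
    refine ⟨fun h => ?_, fun h => le_sup_right (a := Q ⊓ N) h⟩
    obtain ⟨q, hq, m, hm, rfl⟩ := Subgroup.mem_sup_of_normal_left.mp h
    have hq' := ((H ⊔ K).mul_mem_cancel_right (sup_le_sup hH'H hK'K hm)).mp hx
    exact mul_mem (hQM (show (⟨q, hq'⟩ : ↥(H ⊔ K)) ∈ _ from hq.1)) hm
  refine ⟨(Q ⊓ N) ⊔ M, hC.mem_of_le hquot (hC.inf_mem hQ hN) le_sup_left,
    (sup_le inf_le_right (sup_le hH'N hK'N)).trans hle, fun h => ?_, fun h hh k hk hhk => ?_⟩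
  · rw [hmem _ (le_sup_left (a := H) h.2), hmem _ (le_sup_right (a := H) (φ h).2)]
    constructor
    · exact fun h1 => le_sup_right (a := H') ((hK' h).mpr ((hH' h).mp (hMH _ h1 h.2)))
    · exact fun h1 => le_sup_left (a := H') ((hH' h).mpr ((hK' h).mp (hMK _ h1 (φ h).2)))
  · rw [hmem _ (mul_mem (inv_mem (le_sup_left (a := H) hh)) (le_sup_right (a := H) hk))] at hhk
    obtain ⟨h', hh', k', hk', e⟩ := Subgroup.mem_sup_of_normal_left.mp hhk
    have e' : h * h' = k * k'⁻¹ := by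
      rw [eq_mul_inv_iff_mul_eq, mul_assoc, e, mul_inv_cancel_left]
    refine ⟨h * h', ⟨mul_mem hh (hH'H hh'), ?_⟩, ?_⟩
    · rw [e']
      exact K.mul_mem hk (K.inv_mem (hK'K hk'))
    · rw [inv_mul_cancel_left]
      exact le_sup_right (a := Q ⊓ N) (le_sup_left (a := H') hh')

end Sufficiency

section Necessity

variable {C : GroupClass.{u}} {B : Type u} [Group B] {H K : Subgroup B} {φ : H ≃* K}
  {ψ : MulAut ↥(H ⊓ K)}

theorem Residually.of_injective (hC : IsRootClass C) {X Y : Type u} [Group X] [Group Y]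
    (hX : Residually C X) (f : Y →* X) (hf : Function.Injective f) : Residually C Y := by
  refine hC.residually_iff.mpr fun y hy => ?_
  obtain ⟨N, hN, hyN⟩ := hC.residually_iff.mp hX (f y) (by rwa [ne_eq, map_eq_one_iff f hf])
  exact ⟨_, hC.comap_mem f hN, hyN⟩

theorem HNNExtension.exists_conj_eq (φ : H ≃* K) (u : ℤˣ) {a : B}
    (ha : a ∈ HNNExtension.toSubgroup H K u) :
    ∃ a' ∈ HNNExtension.toSubgroup H K (-u),
      (HNNExtension.t ^ (u : ℤ) * HNNExtension.of a * HNNExtension.t ^ (-(u : ℤ)) :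
        HNNExtension B H K φ) = HNNExtension.of a' := by
  rcases Int.units_eq_one_or u with rfl | rfl
  · replace ha : a ∈ H := ha
    refine ⟨φ ⟨a, ha⟩, (φ ⟨a, ha⟩).2, ?_⟩
    simpa using (HNNExtension.equiv_eq_conj ⟨a, ha⟩).symm
  · replace ha : a ∈ K := ha
    refine ⟨φ.symm ⟨a, ha⟩, by simp, ?_⟩
    simpa using (HNNExtension.equiv_symm_eq_conj ⟨a, ha⟩).symm

theorem HNNExtension.not_commute_conj (φ : H ≃* K) (u : ℤˣ) {b y : B}
    (hb : b ∉ HNNExtension.toSubgroup H K u) (hy : y ∉ HNNExtension.toSubgroup H K (-u)) :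
    ¬ Commute (HNNExtension.t ^ (u : ℤ) * HNNExtension.of b * HNNExtension.t ^ (-(u : ℤ)) :
        HNNExtension B H K φ)
      (HNNExtension.of y * (HNNExtension.t ^ (u : ℤ) * HNNExtension.of b *
        HNNExtension.t ^ (-(u : ℤ))) * (HNNExtension.of y)⁻¹) := by
  intro h
  have hb' : b⁻¹ ∉ HNNExtension.toSubgroup H K u := by rwa [inv_mem_iff]
  have hy' : y⁻¹ ∉ HNNExtension.toSubgroup H K (-u) := by rwa [inv_mem_iff]
  let w : HNNExtension.NormalWord.ReducedWord B H K :=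
    { head := 1
      toList := [(u, b), (-u, y), (u, b), (-u, y⁻¹), (u, b⁻¹), (-u, y), (u, b⁻¹), (-u, y⁻¹)]
      chain := by simp [hb, hy] }
  have hw : w.prod φ = 1 := by
    rw [← mul_inv_eq_one.mpr h.eq]
    simp [HNNExtension.NormalWord.ReducedWord.prod, w, mul_assoc]
  simpa [w] using HNNExtension.ReducedWord.toList_eq_nil_of_mem_of_range φ w
    (hw ▸ one_mem _)

theorem IsRestrictionToL.toSubgroup_eq_top (hψ : IsRestrictionToL H K φ ψ) {u : ℤˣ}
    (h : HNNExtension.toSubgroup H K (-u) = ⊤) : HNNExtension.toSubgroup H K u = ⊤ := by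
  rcases Int.units_eq_one_or u with rfl | rfl
  · replace h : K = ⊤ := h
    change H = ⊤
    refine (Subgroup.eq_top_iff' _).mpr fun x => ?_
    obtain ⟨y, hy⟩ := φ.surjective ⟨x, h.ge <| Subgroup.mem_top x⟩
    have := (hψ.mem_iff y).mp ⟨y.2, h.ge <| Subgroup.mem_top _⟩
    rw [hy] at this
    exact this.1
  · replace h : H = ⊤ := by simpa using h
    change K = ⊤
    refine (Subgroup.eq_top_iff' _).mpr fun x => ?_
    exact ((hψ.mem_iff ⟨x, h.ge <| Subgroup.mem_top x⟩).mpr ⟨h.ge (Subgroup.mem_top _), (φ _).2⟩).2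

theorem IsRootClass.exists_mem_of_notMem_toSubgroup (hC : IsRootClass C) (hquot : QuotClosed C)
    [H.Normal] [K.Normal] (hH : LocallyCyclic H) (hK : LocallyCyclic K)
    (hψ : IsRestrictionToL H K φ ψ) (hE : Residually C (HNNExtension B H K φ)) (u : ℤˣ) (b : B)
    (hb : b ∉ HNNExtension.toSubgroup H K u) :
    ∃ N, inCStar C B N ∧ HNNExtension.toSubgroup H K u ≤ N ∧ b ∉ N := by
  obtain ⟨y, hy⟩ : ∃ y, y ∉ HNNExtension.toSubgroup H K (-u) := by
    by_contra! h
    rw [hψ.toSubgroup_eq_top ((Subgroup.eq_top_iff' _).mpr h)] at hb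
    exact hb (Subgroup.mem_top b)
  have hnormal (v : ℤˣ) : (HNNExtension.toSubgroup H K v).Normal := by
    rcases Int.units_eq_one_or v with rfl | rfl <;> simpa
  have hcomm (v : ℤˣ) : ∀ x ∈ HNNExtension.toSubgroup H K v,
      ∀ y ∈ HNNExtension.toSubgroup H K v, x * y = y * x := by
    rcases Int.units_eq_one_or v with rfl | rfl
    · exact fun x hx y hy => congrArg Subtype.val (hH.mul_comm ⟨x, hx⟩ ⟨y, hy⟩)
    · exact fun x hx y hy => congrArg Subtype.val (hK.mul_comm ⟨x, hx⟩ ⟨y, hy⟩)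
  obtain ⟨N, hN, hN'⟩ := hC.residually_iff.mp hE _
    (mt mul_inv_eq_one.mp (HNNExtension.not_commute_conj φ u hb hy))
  obtain ⟨_, -⟩ := id hN
  have := hnormal u
  refine ⟨N.comap HNNExtension.of ⊔ HNNExtension.toSubgroup H K u,
    hC.mem_of_le hquot (hC.comap_mem _ hN) le_sup_left, le_sup_right, fun hmem => hN' ?_⟩
  obtain ⟨m, hm, a, ha, rfl⟩ := Subgroup.mem_sup_of_normal_left.mp hmem
  obtain ⟨a', ha', e⟩ := HNNExtension.exists_conj_eq φ u ha
  have hm' : QuotientGroup.mk' N (HNNExtension.of m) = 1 := (QuotientGroup.eq_one_iff _).mpr hm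
  have e' := congrArg (QuotientGroup.mk' N) e
  simp only [map_mul] at e'
  have hya := congrArg (fun x => QuotientGroup.mk' N (HNNExtension.of x))
    (hcomm _ a' ha' _ ((hnormal (-u)).conj_mem a' ha' y))
  simp only [map_mul, map_inv] at hya
  rw [← QuotientGroup.ker_mk' N, MonoidHom.mem_ker, map_mul, map_inv, mul_inv_eq_one]
  simp only [map_mul, map_inv, hm', one_mul, e']
  exact hya

theorem IsRootClass.zpowers_mem_of_finite (hC : IsRootClass C) (hquot : QuotClosed C)
    (hψ : IsRestrictionToL H K φ ψ) [Finite ↥(H ⊓ K)]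
    (hE : Residually C (HNNExtension B H K φ)) : C (Subgroup.zpowers ψ) := by
  have : Finite ((H ⊓ K).map (HNNExtension.of : B →* HNNExtension B H K φ)) :=
    Set.Finite.image _ (Set.toFinite ((H ⊓ K : Subgroup B) : Set B))
  obtain ⟨N, ⟨_, hN⟩, hbot⟩ := hC.exists_mem_inf_eq_bot hE
    ((H ⊓ K).map (HNNExtension.of : B →* HNNExtension B H K φ))
  let f : ↥(H ⊓ K) →* HNNExtension B H K φ ⧸ N :=
    (QuotientGroup.mk' N).comp (HNNExtension.of.comp (H ⊓ K).subtype)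
  have hf : Function.Injective f := by
    refine (injective_iff_map_eq_one f).mpr fun l hl => ?_
    have := (Subgroup.eq_bot_iff_forall _).mp hbot (HNNExtension.of (l : B))
      ⟨(QuotientGroup.eq_one_iff _).mp hl, l, l.2, rfl⟩
    exact Subtype.ext ((map_eq_one_iff _ (HNNExtension.of_injective φ)).mp this)
  have hconj (l : ↥(H ⊓ K)) :
      MulAut.conj (QuotientGroup.mk' N HNNExtension.t) (f l) = f (ψ l) := by
    have h1 := HNNExtension.equiv_eq_conj (φ := φ) ⟨(l : B), l.2.1⟩
    rw [← hψ l] at h1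
    simpa [f] using (congrArg (QuotientGroup.mk' N) h1).symm
  refine hC.zpowers_of_zpow_eq_one hquot (g := QuotientGroup.mk' N HNNExtension.t)
    (fun n hn => ?_) (hC.2.2.1 _ _ hN)
  ext l
  have := MulAut.zpow_apply_map f hconj n l
  rw [← map_zpow, hn, map_one, MulAut.one_apply] at this
  rw [← hf this]
  rfl

end Necessity

theorem statement_6 (C : GroupClass.{u}) (hroot : IsRootClass C)
    (hper : PeriodicClass C) (hquot : QuotClosed C)
    {B : Type u} [Group B] (H K : Subgroup B) (φ : H ≃* K)
    (hH : H.Normal) (hK : K.Normal)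
    (ψ : MulAut ↥(H ⊓ K)) (hψ : IsRestrictionToL H K φ ψ)
    (hHlc : LocallyCyclic H) (hKlc : LocallyCyclic K) :
    (Residually C (B ⧸ H) → Residually C (B ⧸ K) →
      (Finite (↥H ⧸ (H ⊓ K).subgroupOf H) ↔ C (↥H ⧸ (H ⊓ K).subgroupOf H))) ∧
    (Residually C B →
      (Finite ↥(H ⊓ K) ↔ ∃ (G : Type u) (_ : Group G) (σ : B →* G),
        Function.Surjective σ ∧ C G ∧
          Function.Injective (σ.comp (H ⊓ K).subtype))) ∧
    (Finite (↥H ⧸ (H ⊓ K).subgroupOf H) → C ↥(Subgroup.zpowers ψ) →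
      QuasiRegular C B (H ⊓ K) →
      (Residually C (HNNExtension B H K φ) ↔
        (Residually C B ∧ Residually C (B ⧸ H) ∧ Residually C (B ⧸ K)))) ∧
    (Finite ↥(H ⊓ K) → QuasiRegular C B (H ⊔ K) →
      (Residually C (HNNExtension B H K φ) ↔
        (Residually C B ∧ Residually C (B ⧸ H) ∧ Residually C (B ⧸ K) ∧
          C ↥(Subgroup.zpowers ψ)))) := by
  refine ⟨fun _ hBK => ⟨fun hfin => ?_, fun hHL => ?_⟩, fun hB => ⟨fun hfin => ?_, ?_⟩,
    fun hfin hF _ => ⟨fun hE => ⟨?_, ?_, ?_⟩, fun ⟨hB, hBH, hBK⟩ => ?_⟩,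
    fun hfin hreg => ⟨fun hE => ⟨?_, ?_, ?_, ?_⟩, fun ⟨hB, hBH, hBK, hF⟩ => ?_⟩⟩
  · have hfin' : Finite (H.map (QuotientGroup.mk' K)) := by
      refine Nat.finite_of_card_ne_zero ?_
      rw [← Subgroup.relIndex_ker, QuotientGroup.ker_mk', ← Subgroup.inf_relIndex_left]
      exact Subgroup.index_ne_zero_of_finite
    obtain ⟨N, ⟨_, hN⟩, hbot⟩ := hroot.exists_mem_inf_eq_bot hBK (H.map (QuotientGroup.mk' K))
    let f := (QuotientGroup.mk' N).comp ((QuotientGroup.mk' K).comp H.subtype)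
    have hf : f.ker = (H ⊓ K).subgroupOf H := by
      ext h
      have h1 : f h = 1 ↔ ((h : B) : B ⧸ K) ∈ N := QuotientGroup.eq_one_iff _
      have h2 : ((h : B) : B ⧸ K) ∈ N ↔ (h : B) ∈ K := by
        rw [← QuotientGroup.eq_one_iff (N := K)]
        refine ⟨fun h2 => (Subgroup.eq_bot_iff_forall _).mp hbot _ ⟨h2, h, h.2, rfl⟩, fun h2 => ?_⟩
        rw [h2]
        exact N.one_mem
      simp [MonoidHom.mem_ker, h1, h2, Subgroup.mem_subgroupOf]
    obtain ⟨_, h⟩ := hf ▸ hroot.ker_mem f hN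
    exact h
  · obtain ⟨n, hn, hpow⟩ := hroot.exists_pow_eq_one hper hHL
    have := hHlc.finite_range (QuotientGroup.mk' ((H ⊓ K).subgroupOf H)) hn fun _ => hpow _
    rw [QuotientGroup.range_mk'] at this
    exact Finite.of_equiv _ Subgroup.topEquiv.toEquiv
  · obtain ⟨N, ⟨_, hN⟩, hbot⟩ := hroot.exists_mem_inf_eq_bot hB (H ⊓ K)
    refine ⟨_, inferInstance, QuotientGroup.mk' N, QuotientGroup.mk'_surjective N, hN,
      (injective_iff_map_eq_one _).mpr fun l hl => ?_⟩
    exact Subtype.ext ((Subgroup.eq_bot_iff_forall _).mp hbot l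
      ⟨(QuotientGroup.eq_one_iff _).mp hl, l.2⟩)
  · rintro ⟨G, _, σ, -, hG, hσ⟩
    obtain ⟨n, hn, hpow⟩ := hroot.exists_pow_eq_one hper hG
    have := (hHlc.of_injective _ (Subgroup.inclusion_injective
      (inf_le_left : H ⊓ K ≤ H))).finite_range _ hn fun l => hpow (σ.comp (H ⊓ K).subtype l)
    exact Finite.of_injective _ ((MonoidHom.rangeRestrict_injective_iff).mpr hσ)
  · exact hE.of_injective hroot _ (HNNExtension.of_injective φ)
  · exact (hroot.residually_quotient_iff H).mpr fun b hb =>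
      hroot.exists_mem_of_notMem_toSubgroup hquot hHlc hKlc hψ hE 1 b hb
  · exact (hroot.residually_quotient_iff K).mpr fun b hb => by
      simpa using hroot.exists_mem_of_notMem_toSubgroup hquot hHlc hKlc hψ hE (-1) b
        (by simpa using hb)
  · exact hroot.residually_hnnExtension_of_finite_quotient hper hquot hHlc hKlc hψ hF hfin hB
      hBH hBK
  · exact hE.of_injective hroot _ (HNNExtension.of_injective φ)
  · exact (hroot.residually_quotient_iff H).mpr fun b hb =>
      hroot.exists_mem_of_notMem_toSubgroup hquot hHlc hKlc hψ hE 1 b hb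
  · exact (hroot.residually_quotient_iff K).mpr fun b hb => by
      simpa using hroot.exists_mem_of_notMem_toSubgroup hquot hHlc hKlc hψ hE (-1) b
        (by simpa using hb)
  · exact hroot.zpowers_mem_of_finite hquot hψ hE
  · exact hroot.residually_hnnExtension_of_quasiRegular hper hquot hHlc hKlc hψ hF hreg hB hBH hBK
end

section
/- If 𝒞 is a class of groups closed under taking quotient groups, X is residually a 𝒞-group, and Y is a normal subgroup of X, then the group Aut_X(Y) is also residually a 𝒞-group. -/
universe u

open Subgroup

/-- A surjection `f : X →* G` induces a surjection of `Aut_X(Y)` onto the quotient of `G` by the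
centralizer of `f(Y)`, sending the restriction of conjugation by `x` to the class of `f x`. -/
theorem exists_autOf_hom_quotient_centralizer {X G : Type u} [Group X] [Group G]
    (Y : Subgroup X) [Y.Normal] (f : X →* G) (hf : Function.Surjective f)
    [(centralizer (Y.map f : Set G)).Normal] :
    ∃ F : ↥(autOf X Y) →* G ⧸ centralizer (Y.map f : Set G), Function.Surjective F ∧
      ∀ (α : ↥(autOf X Y)) (x : X), (∀ y : Y, ((α.1 y : Y) : X) = x * y * x⁻¹) →
        F α = QuotientGroup.mk (f x) := by
  have key : ∀ a b : X, (∀ y : Y, a * (y : X) * a⁻¹ = b * y * b⁻¹) →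
      (QuotientGroup.mk (f a) : G ⧸ centralizer (Y.map f : Set G)) = QuotientGroup.mk (f b) := by
    intro a b h
    rw [QuotientGroup.eq, mem_centralizer_iff]
    rintro _ ⟨y, hy, rfl⟩
    have hab : y * (a⁻¹ * b) = a⁻¹ * b * y := by
      calc y * (a⁻¹ * b) = a⁻¹ * (a * y * a⁻¹) * b := by group
        _ = a⁻¹ * (b * y * b⁻¹) * b := by rw [h ⟨y, hy⟩]
        _ = a⁻¹ * b * y := by group
    simpa using congrArg f hab
  choose c hc using fun α : ↥(autOf X Y) => α.2
  refine ⟨MonoidHom.mk' (fun α => QuotientGroup.mk (f (c α))) fun α β => ?_, fun q => ?_,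
    fun α x hx => key _ _ fun y => (hc α y).symm.trans (hx y)⟩
  · rw [← QuotientGroup.mk_mul, ← map_mul]
    refine key _ _ fun y => ?_
    rw [← hc (α * β) y]
    change ((α.1 (β.1 y) : Y) : X) = _
    rw [hc α, hc β]
    group
  · obtain ⟨g, rfl⟩ := QuotientGroup.mk_surjective q
    obtain ⟨x, rfl⟩ := hf g
    have hx : ∀ y : Y, ((MulAut.conjNormal x y : Y) : X) = x * y * x⁻¹ :=
      fun y => MulAut.conjNormal_apply x y
    exact ⟨⟨MulAut.conjNormal x, x, hx⟩, key _ _ fun y => (hc _ y).symm.trans (hx y)⟩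

theorem statement_8 (C : GroupClass.{u}) (hiso : IsoClosed C) (hquot : QuotClosed C)
    (X : Type u) [Group X] (hres : Residually C X) (Y : Subgroup X) (hY : Y.Normal) :
    Residually C ↥(autOf X Y) := by
  rintro ⟨α, x, hx⟩ hα
  obtain ⟨y, hy⟩ : ∃ y : Y, α y ≠ y := by
    by_contra! h
    exact hα (Subtype.ext (MulEquiv.ext h))
  have hxy : x * (y : X) * x⁻¹ * (y : X)⁻¹ ≠ 1 := fun h =>
    hy (Subtype.ext ((hx y).trans (mul_inv_eq_one.mp h)))
  obtain ⟨G, _, f, hf, hG, hfxy⟩ := hres _ hxy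
  have : (Y.map f).Normal := hY.map f hf
  obtain ⟨F, hF, hFx⟩ := exists_autOf_hom_quotient_centralizer Y f hf
  refine ⟨_, _, F, hF, hquot G _ hG, fun h => hfxy ?_⟩
  rw [hFx _ x hx, QuotientGroup.eq_one_iff, mem_centralizer_iff] at h
  have hcomm : f y * f x = f x * f y := h _ ⟨y, y.2, rfl⟩
  simp [← hcomm]
end

section
/- Suppose the HNN-extension 𝔼 = ⟨B, t; t⁻¹Ht = K, φ⟩ satisfies condition (*) and 𝒞 is a root class of groups closed under taking quotient groups. If 𝔼 is residually a 𝒞-group, then 𝔘 and 𝔙 are also residually 𝒞-groups; consequently, each of the groups 𝔥, 𝔎, 𝔏, 𝔉, 𝔘, and 𝔙 belongs to 𝒞 whenever it is finite. -/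
universe u

open Subgroup

/-- The automorphisms of `Y` that become restrictions of inner automorphisms of `E`
along `i : Y →* E`. -/
def innerRealizable {Y E : Type u} [Group Y] [Group E] (i : Y →* E) : Subgroup (MulAut Y) where
  carrier := { α | ∃ x : E, ∀ y : Y, i (α y) = x * i y * x⁻¹ }
  one_mem' := ⟨1, fun y => by simp⟩
  mul_mem' := by
    rintro α β ⟨a, ha⟩ ⟨b, hb⟩
    refine ⟨a * b, fun y => ?_⟩
    rw [MulAut.mul_apply, ha, hb]
    group
  inv_mem' := by
    rintro α ⟨a, ha⟩
    refine ⟨a⁻¹, fun y => ?_⟩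
    have h := ha (α⁻¹ y)
    rw [MulAut.apply_inv_self] at h
    rw [h]
    group

theorem class_range {C : GroupClass.{u}} (hiso : IsoClosed C) (hquot : QuotClosed C)
    {G G' : Type u} [Group G] [Group G'] (f : G →* G') (hG : C G) : C f.range :=
  hiso _ _ (QuotientGroup.quotientKerEquivRange f) (hquot G f.ker hG)

theorem class_of_injective {C : GroupClass.{u}} (hiso : IsoClosed C) (hsub : SubgroupClosed C)
    {G G' : Type u} [Group G] [Group G'] (f : G →* G') (hf : Function.Injective f) (hG : C G') :
    C G :=
  hiso _ _ (MonoidHom.ofInjective hf).symm (hsub G' f.range hG)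

theorem class_of_le {C : GroupClass.{u}} (hiso : IsoClosed C) (hsub : SubgroupClosed C)
    {G : Type u} [Group G] {S T : Subgroup G} (hST : S ≤ T) (hT : C T) : C S :=
  class_of_injective hiso hsub (Subgroup.inclusion hST) (Subgroup.inclusion_injective hST) hT

theorem class_of_subsingleton {C : GroupClass.{u}} (hroot : IsRootClass C)
    {G : Type u} [Group G] [Subsingleton G] : C G := by
  obtain ⟨hiso, ⟨Z, _, hZ, -⟩, hsub, -⟩ := hroot
  exact class_of_injective hiso hsub (1 : G →* Z) (fun _ _ _ => Subsingleton.elim _ _) hZ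

/-- A group of automorphisms induced by conjugation in a residually `C`-group is
residually a `C`-group. -/
theorem residually_of_le_innerRealizable {C : GroupClass.{u}} (hiso : IsoClosed C)
    (hsub : SubgroupClosed C) (hquot : QuotClosed C) {Y E : Type u} [Group Y] [Group E]
    (i : Y →* E) (hi : Function.Injective i) (hE : Residually C E)
    {S : Subgroup (MulAut Y)} (hS : S ≤ innerRealizable i) : Residually C S := by
  intro α hα
  obtain ⟨y, hy⟩ : ∃ y, (α : MulAut Y) y ≠ y := by
    by_contra! h
    exact hα (Subtype.ext (MulEquiv.ext h))
  obtain ⟨G, _, f, -, hG, hfy⟩ := hE (i ((α : MulAut Y) y) * (i y)⁻¹)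
    (fun h => hy (hi (mul_inv_eq_one.mp h)))
  let N : Subgroup G := (f.comp i).range
  have hreal : ∀ σ : S, ∃ x : E, ∀ z : Y, i ((σ : MulAut Y) z) = x * i z * x⁻¹ :=
    fun σ => hS σ.2
  choose x hx using hreal
  have hfx (σ : S) (z : Y) : f (x σ) * f (i z) * (f (x σ))⁻¹ = f (i ((σ : MulAut Y) z)) := by
    rw [hx, map_mul, map_mul, map_inv]
  have hnorm (σ : S) : f (x σ) ∈ Subgroup.normalizer (N : Set G) := by
    rw [Subgroup.mem_normalizer_iff]
    intro g
    constructor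
    · rintro ⟨z, rfl⟩
      exact ⟨(σ : MulAut Y) z, (hfx σ z).symm⟩
    · rintro ⟨z, hz⟩
      refine ⟨(σ : MulAut Y)⁻¹ z, ?_⟩
      have h := hfx σ ((σ : MulAut Y)⁻¹ z)
      rw [MulAut.apply_inv_self] at h
      exact mul_left_cancel (mul_right_cancel (h.trans hz))
  let κ : Subgroup.normalizer (N : Set G) →* MulAut N := N.normalizerMonoidHom
  have hκ (σ : S) (z : Y) : ((κ ⟨f (x σ), hnorm σ⟩ ⟨f (i z), z, rfl⟩ : N) : G) =
      f (i ((σ : MulAut Y) z)) := hfx σ z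
  let ρ : S →* MulAut N := MonoidHom.mk' (fun σ => κ ⟨f (x σ), hnorm σ⟩) (by
    intro σ τ
    ext ⟨_, z, rfl⟩
    have h : κ ⟨f (x τ), hnorm τ⟩ ⟨f (i z), z, rfl⟩ =
        ⟨f (i ((τ : MulAut Y) z)), (τ : MulAut Y) z, rfl⟩ := Subtype.ext (hκ τ z)
    refine (hκ (σ * τ) z).trans ?_
    rw [MulAut.mul_apply]
    refine Eq.trans ?_ (congrArg (fun n : N => ((κ ⟨f (x σ), hnorm σ⟩ n : N) : G)) h.symm)
    exact (hκ σ ((τ : MulAut Y) z)).symm)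
  have hρ : ρ.range ≤ κ.range := by
    rintro _ ⟨σ, rfl⟩
    exact ⟨⟨f (x σ), hnorm σ⟩, rfl⟩
  refine ⟨ρ.range, inferInstance, ρ.rangeRestrict, ρ.rangeRestrict_surjective,
    class_of_le hiso hsub hρ (class_range hiso hquot κ (hsub G _ hG)), fun h => hfy ?_⟩
  have h1 : ρ α = 1 := congrArg Subtype.val h
  have h2 := hκ α y
  rw [show κ ⟨f (x α), hnorm α⟩ = 1 from h1] at h2
  rw [map_mul, map_inv, ← h2]
  exact mul_inv_cancel _

theorem inCStar_inf {C : GroupClass.{u}} (hroot : IsRootClass C) {X : Type u} [Group X]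
    {M N : Subgroup X} (hM : inCStar C X M) (hN : inCStar C X N) :
    ∃ T : Subgroup X, inCStar C X T ∧ T ≤ M ⊓ N := by
  obtain ⟨hiso, -, hsub, hgru⟩ := hroot
  obtain ⟨hMn, hM⟩ := hM
  obtain ⟨hNn, hN⟩ := hN
  let f : M →* X ⧸ N := (QuotientGroup.mk' N).comp M.subtype
  have hker : f.ker = (M ⊓ N).subgroupOf M := by
    ext z
    simp [f, Subgroup.mem_subgroupOf]
  have hnorm : ((M ⊓ N).subgroupOf M).Normal := hker ▸ f.normal_ker
  have hC : C (↥M ⧸ (M ⊓ N).subgroupOf M) :=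
    hiso _ _ ((QuotientGroup.quotientKerEquivRange f).symm.trans
      (QuotientGroup.quotientMulEquivOfEq hker)) (hsub _ f.range hN)
  obtain ⟨T, hT, hle, hCT⟩ := hgru X M (M ⊓ N) inf_le_left hMn hnorm hM hC
  exact ⟨T, ⟨hT, hCT⟩, hle⟩

theorem class_of_finite_of_residually {C : GroupClass.{u}} (hroot : IsRootClass C)
    {X : Type u} [Group X] [Finite X] (hX : Residually C X) : C X := by
  classical
  have key (s : Finset X) : ∃ N : Subgroup X, inCStar C X N ∧ ∀ x ∈ s, x ∈ N → x = 1 := by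
    induction s using Finset.induction_on with
    | empty =>
      have : Subsingleton (X ⧸ (⊤ : Subgroup X)) := QuotientGroup.subsingleton_quotient_top
      exact ⟨⊤, ⟨inferInstance, class_of_subsingleton hroot⟩, by simp⟩
    | insert a s _ ih =>
      obtain ⟨N, hN, hs⟩ := ih
      by_cases ha : a = 1
      · refine ⟨N, hN, fun x hx hxN => ?_⟩
        rcases Finset.mem_insert.mp hx with rfl | hx
        · exact ha
        · exact hs x hx hxN
      · obtain ⟨G, _, f, hf, hG, hfa⟩ := hX a ha
        have hker : inCStar C X f.ker :=
          ⟨inferInstance,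
            hroot.1 _ _ (QuotientGroup.quotientKerEquivOfSurjective f hf).symm hG⟩
        obtain ⟨T, hT, hle⟩ := inCStar_inf hroot hN hker
        refine ⟨T, hT, fun x hx hxT => ?_⟩
        rcases Finset.mem_insert.mp hx with rfl | hx
        · exact absurd (MonoidHom.mem_ker.mp (hle hxT).2) hfa
        · exact hs x hx (hle hxT).1
  have := Fintype.ofFinite X
  obtain ⟨N, ⟨hNn, hN⟩, h⟩ := key Finset.univ
  obtain rfl : N = ⊥ := (Subgroup.eq_bot_iff_forall N).mpr fun x => h x (Finset.mem_univ x)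
  exact hroot.1 _ _ QuotientGroup.quotientBot hN

theorem autOf_le_innerRealizable {B E : Type u} [Group B] [Group E] (Y : Subgroup B)
    (j : B →* E) : autOf B Y ≤ innerRealizable (j.comp Y.subtype) := by
  rintro α ⟨x, hx⟩
  exact ⟨j x, fun y => by simp [hx]⟩

theorem frakK_le_innerRealizable {B : Type u} [Group B] (H K : Subgroup B) (φ : H ≃* K) :
    frakK H K φ ≤
      innerRealizable ((HNNExtension.of : B →* HNNExtension B H K φ).comp H.subtype) := by
  rintro _ ⟨α, ⟨b, hb⟩, rfl⟩
  refine ⟨HNNExtension.t⁻¹ * HNNExtension.of b * HNNExtension.t, fun y => ?_⟩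
  change HNNExtension.of ((φ.symm (α (φ y)) : H) : B) = _
  rw [HNNExtension.equiv_symm_eq_conj, hb, map_mul, map_mul, map_inv,
    HNNExtension.equiv_eq_conj]
  simp only [MonoidHom.comp_apply, Subgroup.subtype_apply]
  group

theorem zpowers_le_innerRealizable {B : Type u} [Group B] (H K : Subgroup B) (φ : H ≃* K)
    (ψ : MulAut ↥(H ⊓ K)) (hψ : IsRestrictionToL H K φ ψ) :
    Subgroup.zpowers ψ ≤
      innerRealizable ((HNNExtension.of : B →* HNNExtension B H K φ).comp (H ⊓ K).subtype) := by
  rw [Subgroup.zpowers_le]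
  refine ⟨HNNExtension.t, fun y => ?_⟩
  simp only [MonoidHom.comp_apply, Subgroup.subtype_apply]
  rw [hψ y, HNNExtension.equiv_eq_conj]

theorem statement_10 (C : GroupClass.{u}) (hroot : IsRootClass C) (hquot : QuotClosed C)
    {B : Type u} [Group B] (H K : Subgroup B) (φ : H ≃* K)
    (hH : H.Normal) (hK : K.Normal)
    (ψ : MulAut ↥(H ⊓ K)) (hψ : IsRestrictionToL H K φ ψ)
    (hres : Residually C (HNNExtension B H K φ)) :
    Residually C ↥(frakU H K φ) ∧ Residually C ↥(frakV H K ψ) ∧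
    (Finite ↥(autOf B H) → C ↥(autOf B H)) ∧
    (Finite ↥(frakK H K φ) → C ↥(frakK H K φ)) ∧
    (Finite ↥(autOf B (H ⊓ K)) → C ↥(autOf B (H ⊓ K))) ∧
    (Finite ↥(Subgroup.zpowers ψ) → C ↥(Subgroup.zpowers ψ)) ∧
    (Finite ↥(frakU H K φ) → C ↥(frakU H K φ)) ∧
    (Finite ↥(frakV H K ψ) → C ↥(frakV H K ψ)) := by
  have res (Y : Subgroup B) {S : Subgroup (MulAut Y)}
      (hS : S ≤ innerRealizable
        ((HNNExtension.of : B →* HNNExtension B H K φ).comp Y.subtype)) : Residually C S :=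
    residually_of_le_innerRealizable hroot.1 hroot.2.2.1 hquot _
      (fun _ _ h => Y.subtype_injective (HNNExtension.of_injective φ h)) hres hS
  have rh := res H (autOf_le_innerRealizable H _)
  have rk := res H (frakK_le_innerRealizable H K φ)
  have rl := res (H ⊓ K) (autOf_le_innerRealizable (H ⊓ K) _)
  have rf := res (H ⊓ K) (zpowers_le_innerRealizable H K φ ψ hψ)
  have ru : Residually C ↥(frakU H K φ) :=
    res H (sup_le (autOf_le_innerRealizable H _) (frakK_le_innerRealizable H K φ))
  have rv : Residually C ↥(frakV H K ψ) :=
    res (H ⊓ K) (sup_le (autOf_le_innerRealizable (H ⊓ K) _)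
      (zpowers_le_innerRealizable H K φ ψ hψ))
  exact ⟨ru, rv, fun _ => class_of_finite_of_residually hroot rh,
    fun _ => class_of_finite_of_residually hroot rk,
    fun _ => class_of_finite_of_residually hroot rl,
    fun _ => class_of_finite_of_residually hroot rf,
    fun _ => class_of_finite_of_residually hroot ru,
    fun _ => class_of_finite_of_residually hroot rv⟩
end

section
/- Suppose the HNN-extension 𝔼 = ⟨B, t; t⁻¹Ht = K, φ⟩ satisfies condition (*), 𝒞 is a root class of groups, and H ∩ K = 1. If B/H ∈ 𝒞, B/K ∈ 𝒞, B/HK ∈ 𝒞, and Aut_{𝔹_{K,H}}(HK/K) ∈ 𝒞, then there exists a homomorphism of 𝔼 onto a group from 𝒞 acting injectively on B. -/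
universe u

open Subgroup

section BKH

variable {B : Type u} [Group B]

/-- The two factors `B/H` and `B/K` of the amalgamated product `𝔹_{K,H}`. -/
def BKHfactors (H K : Subgroup B) [H.Normal] [K.Normal] : Bool → Type u :=
  fun b => cond b (B ⧸ K) (B ⧸ H)

instance (H K : Subgroup B) [H.Normal] [K.Normal] : ∀ b, Group (BKHfactors H K b) :=
  fun b => by
    cases b
    · exact inferInstanceAs (Group (B ⧸ H))
    · exact inferInstanceAs (Group (B ⧸ K))

/-- The two maps from a copy of `H` (whose images are the amalgamated subgroups
`HK/K ≤ B/K` and `KH/H ≤ B/H`), namely `h ↦ hK` and `h ↦ (hφ)H`; the resulting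
pushout identifies `hK` with `(hφ)H`, i.e. amalgamates along `φ_{K,H}`. -/
def BKHmaps (H K : Subgroup B) (φ : H ≃* K) [H.Normal] [K.Normal] :
    ∀ b, ↥H →* BKHfactors H K b
  | false => (QuotientGroup.mk' H).comp (K.subtype.comp φ.toMonoidHom)
  | true => (QuotientGroup.mk' K).comp H.subtype

/-- The amalgamated free product `𝔹_{K,H} = ⟨(B/K) * (B/H); HK/K = KH/H, φ_{K,H}⟩`. -/
def BKH (H K : Subgroup B) (φ : H ≃* K) [H.Normal] [K.Normal] : Type u :=
  Monoid.PushoutI (BKHmaps H K φ)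

instance (H K : Subgroup B) (φ : H ≃* K) [H.Normal] [K.Normal] : Group (BKH H K φ) :=
  inferInstanceAs (Group (Monoid.PushoutI _))

/-- The amalgamated subgroup `HK/K` of `𝔹_{K,H}`. -/
def BKHamalg (H K : Subgroup B) (φ : H ≃* K) [H.Normal] [K.Normal] :
    Subgroup (BKH H K φ) :=
  MonoidHom.range (Monoid.PushoutI.base (BKHmaps H K φ))

end BKH

namespace IsRootClass

variable {C : GroupClass.{u}}

theorem of_injective_s11 (hC : IsRootClass C) {X Y : Type u} [Group X] [Group Y] (f : X →* Y)
    (hf : Function.Injective f) (hY : C Y) : C X :=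
  hC.1 _ _ (MonoidHom.ofInjective hf).symm (hC.2.2.1 Y f.range hY)

/-- If a homomorphism `f` of `X` and a homomorphism `g` of its kernel have images in a root class,
and no non-trivial normal subgroup of `X` lies in the kernel of `g`, then `X` is in the class. -/
theorem of_ker (hC : IsRootClass C) {X Q R : Type u} [Group X] [Group Q] [Group R]
    (f : X →* Q) (g : f.ker →* R) (hQ : C Q) (hR : C R)
    (hT : ∀ T : Subgroup X, T.Normal → T ≤ g.ker.map f.ker.subtype → T = ⊥) : C X := by
  have hZ : (g.ker.map f.ker.subtype).subgroupOf f.ker = g.ker :=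
    Subgroup.comap_map_eq_self_of_injective f.ker.subtype_injective _
  have hZY : ((g.ker.map f.ker.subtype).subgroupOf f.ker).Normal := by
    rw [hZ]; infer_instance
  obtain ⟨T, hTn, hTle, hCT⟩ := hC.2.2.2 X f.ker (g.ker.map f.ker.subtype)
    (Subgroup.map_subtype_le _) inferInstance hZY
    (hC.of_injective_s11 (QuotientGroup.kerLift f) (QuotientGroup.kerLift_injective f) hQ)
    (hC.of_injective_s11
      ((QuotientGroup.kerLift g).comp (QuotientGroup.quotientMulEquivOfEq hZ).toMonoidHom)
      ((QuotientGroup.kerLift_injective g).comp (MulEquiv.injective _)) hR)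
  obtain rfl := hT T hTn hTle
  exact hC.1 _ _ QuotientGroup.quotientBot hCT

theorem semidirectProduct (hC : IsRootClass C) {N G : Type u} [Group N] [Group G]
    (θ : G →* MulAut N) (hN : C N) (hG : C G) : C (N ⋊[θ] G) := by
  let g : (SemidirectProduct.rightHom : N ⋊[θ] G →* G).ker →* N :=
    { toFun := fun x => x.1.left
      map_one' := rfl
      map_mul' := fun x y => by
        have hx : x.1.right = 1 := x.2
        simp [hx] }
  refine hC.of_ker SemidirectProduct.rightHom g hG hN fun T _ hT => ?_
  rw [eq_bot_iff]
  intro x hx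
  obtain ⟨⟨y, hy⟩, hgy, rfl⟩ := hT hx
  exact SemidirectProduct.ext hgy hy

theorem regularWreathProduct (hC : IsRootClass C) {D Q : Type u} [Group D] [Group Q]
    (hD : C D) (hQ : C Q) : C (D ≀ᵣ Q) := by
  let g : (RegularWreathProduct.rightHom : D ≀ᵣ Q →* Q).ker →* D :=
    { toFun := fun x => x.1.left 1
      map_one' := rfl
      map_mul' := fun x y => by
        have hx : x.1.right = 1 := x.2
        simp [hx] }
  refine hC.of_ker RegularWreathProduct.rightHom g hQ hD fun T hTn hT => ?_
  have key : ∀ x ∈ T, x.right = 1 ∧ x.left 1 = 1 := by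
    intro x hx
    obtain ⟨⟨y, hy⟩, hgy, rfl⟩ := hT hx
    exact ⟨hy, hgy⟩
  rw [eq_bot_iff]
  intro x hx
  refine RegularWreathProduct.ext (funext fun q => ?_) (key x hx).1
  have := (key _ (hTn.conj_mem x hx (RegularWreathProduct.inl q⁻¹))).2
  simpa using this

end IsRootClass

section TwistedEmbedding

variable {B Q A U : Type u} [Group B] [Group Q] [Group A] [Group U]

/-- A version of the Kaloujnine–Krasner embedding of an extension with quotient `Q` into a wreath
product, twisted by an action `u` so that the kernel of `π` is mapped to constant functions. -/
noncomputable def twistedEmbedding (θ : U →* MulAut A) (π : B →* Q)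
    (hπ : Function.Surjective π) (r : π.ker →* A) (u : B →* U)
    (hr : ∀ (b : B) (x y : π.ker), (y : B) = b * x * b⁻¹ → r y = θ (u b) (r x)) :
    B →* (A ⋊[θ] U) ≀ᵣ Q :=
  let s := Function.surjInv hπ
  have hs : ∀ q, π (s q) = q := Function.surjInv_eq hπ
  { toFun := fun b =>
      ⟨fun q => ⟨r ⟨b * (s ((π b)⁻¹ * q) * (s q)⁻¹), by simp [MonoidHom.mem_ker, hs]⟩,
        (u (s ((π b)⁻¹ * q) * (s q)⁻¹))⁻¹⟩, π b⟩
    map_one' := by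
      ext q
      · exact (congrArg r (Subtype.ext (by simp))).trans r.map_one
      · simp
      · simp
    map_mul' := fun b c => by
      ext q
      · simp only [RegularWreathProduct.mul_left, Pi.mul_apply, SemidirectProduct.mul_left]
        rw [← map_inv u, ← hr _ _ ⟨(s ((π b)⁻¹ * q) * (s q)⁻¹)⁻¹ *
          (c * (s ((π c)⁻¹ * ((π b)⁻¹ * q)) * (s ((π b)⁻¹ * q))⁻¹)) *
          (s ((π b)⁻¹ * q) * (s q)⁻¹)⁻¹⁻¹, by
            simp [MonoidHom.mem_ker, hs, mul_assoc]⟩ rfl, ← map_mul r]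
        congr 1
        ext
        simp [mul_assoc]
      · simp [mul_assoc]
      · simp }

variable {θ : U →* MulAut A} {π : B →* Q} {hπ : Function.Surjective π} {r : π.ker →* A}
  {u : B →* U} {hr : ∀ (b : B) (x y : π.ker), (y : B) = b * x * b⁻¹ → r y = θ (u b) (r x)}

theorem twistedEmbedding_of_mem_ker (x : π.ker) :
    twistedEmbedding θ π hπ r u hr x = ⟨fun _ => ⟨r x, 1⟩, 1⟩ := by
  have hx : π x = 1 := x.2
  ext q
  · simp [twistedEmbedding, hx]
  · simp [twistedEmbedding, hx]
  · exact hx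

end TwistedEmbedding

/-- Two homomorphisms of `B` into `M` that are interchanged by `φ` yield a homomorphism of the
HNN-extension into a wreath product, for any non-trivial element `s` of the top group. -/
theorem exists_hnn_to_wreath {B M T : Type u} [Group B] [Group M] [Group T] (H K : Subgroup B)
    (φ : H ≃* K) (α β : B →* M) (hβ : ∀ h : H, β h = 1) (hα : ∀ k : K, α k = 1)
    (hαβ : ∀ h : H, β (φ h) = α h) (s : T) (hs : s ≠ 1) :
    ∃ F : HNNExtension B H K φ →* M ≀ᵣ T,
      ∀ b : B, F (HNNExtension.of b) = 1 → α b = 1 ∧ β b = 1 := by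
  classical
  let f : B →* M ≀ᵣ T :=
    { toFun := fun b => ⟨fun x => if x = 1 then α b else if x = s then β b else 1, 1⟩
      map_one' := by ext x <;> simp
      map_mul' := fun b c => by
        ext x
        · by_cases h1 : x = 1
          · simp [h1]
          · by_cases h2 : x = s <;> simp [h1, h2, hs]
        · simp }
  refine ⟨HNNExtension.lift f (RegularWreathProduct.inl s) fun h => ?_, fun b hb => ?_⟩
  · ext x
    · by_cases h2 : x = s
      · simp [f, hβ, hα, hαβ, h2, hs]
      · have h3 : s⁻¹ * x ≠ 1 := fun h => h2 (inv_mul_eq_one.1 h).symm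
        simp [f, hβ, hα, h2, h3]
    · simp [f]
  · rw [HNNExtension.lift_of] at hb
    have h := congrArg RegularWreathProduct.left hb
    exact ⟨by simpa [f] using congrFun h 1, by simpa [f, hs] using congrFun h s⟩

/-- The internal direct product decomposition of `H ⊔ K` for disjoint normal `H` and `K`. -/
theorem exists_mulEquiv_sup {B : Type u} [Group B] (H K : Subgroup B) (hH : H.Normal)
    (hK : K.Normal) (hd : Disjoint H K) :
    ∃ e : H × K ≃* ↥(H ⊔ K), ∀ p, (e p : B) = p.1 * p.2 := by
  have hc : ∀ (h : H) (k : K), Commute (H.subtype h) (K.subtype k) := fun h k =>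
    Subgroup.commute_of_normal_of_disjoint H K hH hK hd _ _ h.2 k.2
  let f : H × K →* ↥(H ⊔ K) := (H.subtype.noncommCoprod K.subtype hc).codRestrict _ fun p => by
    simpa using Subgroup.mul_mem_sup p.1.2 p.2.2
  refine ⟨MulEquiv.ofBijective f ⟨fun p q h => ?_, fun x => ?_⟩, fun p => ?_⟩
  · exact Subgroup.mul_injective_of_disjoint hd (congrArg Subtype.val h)
  · obtain ⟨y, hy, z, hz, h⟩ := Subgroup.mem_sup_of_normal_right.1 x.2
    exact ⟨(⟨y, hy⟩, ⟨z, hz⟩), Subtype.ext h⟩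
  · rfl

section Amalgam

variable {B : Type u} [Group B] (H K : Subgroup B) (φ : H ≃* K) [H.Normal] [K.Normal]

theorem BKHmaps_injective (hd : H ⊓ K = ⊥) (b : Bool) :
    Function.Injective (BKHmaps H K φ b) := by
  rw [injective_iff_map_eq_one]
  intro x hx
  cases b
  · have h1 : ((φ x : K) : B) ∈ H := (QuotientGroup.eq_one_iff _).1 hx
    have h2 : ((φ x : K) : B) ∈ H ⊓ K := ⟨h1, (φ x).2⟩
    rw [hd, Subgroup.mem_bot] at h2
    exact φ.map_eq_one_iff.1 (Subtype.ext h2)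
  · have h1 : (x : B) ∈ K := (QuotientGroup.eq_one_iff _).1 hx
    have h2 : (x : B) ∈ H ⊓ K := ⟨x.2, h1⟩
    rw [hd, Subgroup.mem_bot] at h2
    exact Subtype.ext h2

/-- If conjugation by an element `x` of a factor realizes an automorphism `a` of `H`, then `a`
corresponds to an element of `Aut_{𝔹_{K,H}}(HK/K)`. -/
theorem congr_mem_autOf (e : H ≃* BKHamalg H K φ)
    (he : ∀ h, (e h : BKH H K φ) = Monoid.PushoutI.base (BKHmaps H K φ) h) (b : Bool)
    (x : BKHfactors H K b) (a : MulAut H)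
    (ha : ∀ h, BKHmaps H K φ b (a h) = x * BKHmaps H K φ b h * x⁻¹) :
    MulAut.congr e a ∈ autOf (BKH H K φ) (BKHamalg H K φ) := by
  refine ⟨Monoid.PushoutI.of (φ := BKHmaps H K φ) b x, fun y => ?_⟩
  obtain ⟨h, rfl⟩ := e.surjective y
  have h1 : MulAut.congr e a (e h) = e (a h) := by simp [MulAut.congr]
  rw [h1, he, he]
  have h2 := Monoid.PushoutI.of_apply_eq_base (BKHmaps H K φ) b
  erw [← h2, ← h2, ha]
  simp only [map_mul, map_inv]
  rfl

end Amalgam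

theorem statement_11 (C : GroupClass.{u}) (hroot : IsRootClass C)
    {B : Type u} [Group B] (H K : Subgroup B) (φ : H ≃* K)
    (hH : H.Normal) (hK : K.Normal)
    (hinv : PhiInvL H K φ)
    (htriv : H ⊓ K = ⊥)
    (hBH : C (B ⧸ H)) (hBK : C (B ⧸ K)) (hBHK : C (B ⧸ (H ⊔ K)))
    (hAut : C ↥(autOf (BKH H K φ) (BKHamalg H K φ))) :
    ∃ (G : Type u) (_ : Group G) (f : HNNExtension B H K φ →* G),
      Function.Surjective f ∧ C G ∧ Function.Injective (f.comp HNNExtension.of) := by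
  have := hH
  have := hK
  have hd : Disjoint H K := disjoint_iff.2 htriv
  let e : H ≃* BKHamalg H K φ := MonoidHom.ofInjective
    (Monoid.PushoutI.base_injective (BKHmaps_injective H K φ htriv))
  have he : ∀ h, (e h : BKH H K φ) = Monoid.PushoutI.base (BKHmaps H K φ) h := fun h => rfl
  let U : Subgroup (MulAut H) :=
    (autOf (BKH H K φ) (BKHamalg H K φ)).comap (MulAut.congr e).toMonoidHom
  have hU : C U := hroot.of_injective_s11 ((MulAut.congr e).toMonoidHom.subgroupComap _)
    (fun a b h => Subtype.ext ((MulAut.congr e).injective (congrArg Subtype.val h))) hAut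
  have hCH : C H := hroot.of_injective_s11 _ (BKHmaps_injective H K φ htriv true) hBK
  let u₁ : B →* U := MulAut.conjNormal.codRestrict U fun b =>
    congr_mem_autOf H K φ e he true (QuotientGroup.mk' K b) _ fun h => by
      exact (congrArg (QuotientGroup.mk' K) (MulAut.conjNormal_apply b h)).trans
        (by simp only [map_mul, map_inv]; rfl)
  let u₂ : B →* U :=
    ((MulAut.congr φ.symm).toMonoidHom.comp MulAut.conjNormal).codRestrict U fun b =>
      congr_mem_autOf H K φ e he false (QuotientGroup.mk' H b) _ fun h => by
        have h1 : φ (φ.symm (MulAut.conjNormal b (φ h))) = MulAut.conjNormal b (φ h) :=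
          φ.apply_symm_apply _
        exact (congrArg (fun k : K => QuotientGroup.mk' H k) h1).trans
          ((congrArg (QuotientGroup.mk' H) (MulAut.conjNormal_apply b (φ h))).trans
            (by simp only [map_mul, map_inv]; rfl))
  obtain ⟨d, hdp⟩ := exists_mulEquiv_sup H K hH hK hd
  let π : B →* B ⧸ (H ⊔ K) := QuotientGroup.mk' (H ⊔ K)
  have hker : π.ker = H ⊔ K := QuotientGroup.ker_mk' _
  let c : π.ker →* H × K := d.symm.toMonoidHom.comp (MulEquiv.subgroupCongr hker).toMonoidHom
  have hc : ∀ (x : π.ker) (p : H × K), (x : B) = p.1 * p.2 → c x = p := fun x p h => by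
    refine d.symm_apply_eq.2 (Subtype.ext ?_)
    rw [hdp]
    exact h
  have hc' : ∀ x : π.ker, (x : B) = (c x).1 * (c x).2 := fun x => by
    rw [← hdp]
    simp [c]
  have hconj : ∀ (b : B) (x y : π.ker), (y : B) = b * x * b⁻¹ →
      c y = (MulAut.conjNormal b (c x).1, MulAut.conjNormal b (c x).2) := fun b x y h => by
    refine hc _ _ ?_
    rw [h, hc' x]
    simp [mul_assoc]
  let α := twistedEmbedding U.subtype π (QuotientGroup.mk'_surjective _)
    ((MonoidHom.fst H K).comp c) u₁ fun b x y h => by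
      simp only [MonoidHom.comp_apply, hconj b x y h]
      rfl
  let β := twistedEmbedding U.subtype π (QuotientGroup.mk'_surjective _)
    (φ.symm.toMonoidHom.comp ((MonoidHom.snd H K).comp c)) u₂ fun b x y h => by
      have h1 : φ (φ.symm (c x).2) = (c x).2 := φ.apply_symm_apply _
      simp only [MonoidHom.comp_apply, hconj b x y h]
      exact congrArg (fun k => φ.symm (MulAut.conjNormal b k)) h1.symm
  have hmemH : ∀ h : H, (h : B) ∈ π.ker := fun h => hker.ge (Subgroup.mem_sup_left h.2)
  have hmemK : ∀ k : K, (k : B) ∈ π.ker := fun k => hker.ge (Subgroup.mem_sup_right k.2)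
  have hcH : ∀ h : H, c ⟨h, hmemH h⟩ = (h, 1) := fun h => hc _ _ (by simp)
  have hcK : ∀ k : K, c ⟨k, hmemK k⟩ = (1, k) := fun k => hc _ _ (by simp)
  have hα_ker : ∀ x : π.ker, α x = ⟨fun _ => ⟨(c x).1, 1⟩, 1⟩ := twistedEmbedding_of_mem_ker
  have hβ_ker : ∀ x : π.ker, β x = ⟨fun _ => ⟨φ.symm (c x).2, 1⟩, 1⟩ :=
    twistedEmbedding_of_mem_ker
  have hαk : ∀ k : K, α k = 1 := fun k => by
    rw [hα_ker ⟨k, hmemK k⟩, hcK]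
    rfl
  have hβh : ∀ h : H, β h = 1 := fun h => by
    rw [hβ_ker ⟨h, hmemH h⟩, hcH, map_one]
    rfl
  have hαβ : ∀ h : H, β (φ h) = α h := fun h => by
    rw [hα_ker ⟨h, hmemH h⟩, hβ_ker ⟨φ h, hmemK _⟩, hcH, hcK, φ.symm_apply_apply]
  obtain ⟨T, _, hT, hTn⟩ := hroot.2.1
  obtain ⟨s, hs⟩ := exists_ne (1 : T)
  obtain ⟨F, hF⟩ := exists_hnn_to_wreath H K φ α β hβh hαk hαβ s hs
  refine ⟨F.range, inferInstance, F.rangeRestrict, F.rangeRestrict_surjective,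
    hroot.2.2.1 _ _ (hroot.regularWreathProduct (hroot.regularWreathProduct
      (hroot.semidirectProduct _ hCH hU) hBHK) hT), ?_⟩
  rw [injective_iff_map_eq_one]
  intro b hb
  obtain ⟨hα, hβ⟩ := hF b (congrArg Subtype.val hb)
  have hbk : b ∈ π.ker := congrArg RegularWreathProduct.right hα
  have h1 := (hα_ker ⟨b, hbk⟩).symm.trans hα
  have h2 := (hβ_ker ⟨b, hbk⟩).symm.trans hβ
  have h1' := congrArg SemidirectProduct.left (congrFun (congrArg RegularWreathProduct.left h1) 1)
  have h2' := congrArg SemidirectProduct.left (congrFun (congrArg RegularWreathProduct.left h2) 1)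
  have h3 : (c ⟨b, hbk⟩).1 = 1 := h1'
  have h4 : (c ⟨b, hbk⟩).2 = 1 := φ.symm.map_eq_one_iff.1 h2'
  have := hc' ⟨b, hbk⟩
  simpa [h3, h4] using this
end
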